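/- arXiv:0911.3437 — 2 statements merged into one kernel-verified Lean document; each statement's English description precedes it below -/
import Mathlib

section
/- (Sawyer, Nazarov–Treil–Volberg bilinear embedding theorem, p = q = 2.) Let τ = (τ_Q)_{Q∈𝒬} be nonnegative constants and let ω, σ be weights on ℝ^d. Define C_1^2 = sup_{R∈𝒬, σ(R)>0} σ(R)^{-1} ∫ [∑_{Q∈𝒬, Q⊆R} τ_Q 1_Q E_Q σ]^2 ω dx, C_2^2 = sup_{R∈𝒬, ω(R)>0} ω(R)^{-1} ∫ [∑_{Q∈𝒬, Q⊆R} τ_Q 1_Q E_Q ω]^2 σ dx, and C_3 = sup{ ∑_{Q∈𝒬} τ_Q · E_Q(fσ) · E_Q(gω) · |Q| : f ≥ 0, g ≥ 0, ‖f‖_{L^2(σ)} = ‖g‖_{L^2(ω)} = 1 }. Then there are constants c, C > 0 depending only on d such that c·(C_1 + C_2) ≤ C_3 ≤ C·(C_1 + C_2), all quantities understood in [0,∞]. -/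
open MeasureTheory ENNReal

noncomputable section

/-- Index set for dyadic cubes of `ℝ^d`: a scale `k : ℤ` and a position `n ∈ ℤ^d`. -/
abbrev DIdx (d : ℕ) : Type := ℤ × (Fin d → ℤ)

/-- The dyadic cube `∏_j [2^k n_j, 2^k (n_j + 1))` of `ℝ^d`. -/
def dcube {d : ℕ} (i : DIdx d) : Set (Fin d → ℝ) :=
  {x | ∀ j, x j ∈ Set.Ico ((2 : ℝ) ^ i.1 * (i.2 j : ℝ)) ((2 : ℝ) ^ i.1 * ((i.2 j : ℝ) + 1))}

/-- The dyadic parent of a dyadic cube: the minimal dyadic cube strictly containing it. -/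
def dparent {d : ℕ} (i : DIdx d) : DIdx d :=
  (i.1 + 1, fun j => Int.fdiv (i.2 j) 2)

/-- The measure `ω dx` on `ℝ^d` associated with a weight `ω`. -/
def wMeasure {d : ℕ} (ω : (Fin d → ℝ) → ℝ≥0∞) : Measure (Fin d → ℝ) :=
  volume.withDensity ω

/-- The average of a nonnegative function `f` over the dyadic cube indexed by `i`,
with respect to the measure `μ`. -/
def cavg {d : ℕ} (μ : Measure (Fin d → ℝ)) (i : DIdx d) (f : (Fin d → ℝ) → ℝ≥0∞) : ℝ≥0∞ :=
  (∫⁻ x in dcube i, f x ∂μ) / μ (dcube i)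

/-- Lebesgue average of a nonnegative function over a dyadic cube. -/
def lavg {d : ℕ} (i : DIdx d) (f : (Fin d → ℝ) → ℝ≥0∞) : ℝ≥0∞ :=
  cavg volume i f

/-- The `L^p` norm (real exponent `p`) of a nonnegative function with respect to `μ`. -/
def lpn {d : ℕ} (p : ℝ) (μ : Measure (Fin d → ℝ)) (f : (Fin d → ℝ) → ℝ≥0∞) : ℝ≥0∞ :=
  (∫⁻ x, f x ^ p ∂μ) ^ (1 / p)

/-- The positive dyadic operator `T_τ f = ∑_Q τ_Q (E_Q f) 1_Q`. -/
def Tdy {d : ℕ} (τ : DIdx d → ℝ≥0∞) (f : (Fin d → ℝ) → ℝ≥0∞) (x : Fin d → ℝ) : ℝ≥0∞ :=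
  ∑' i : DIdx d, (dcube i).indicator (fun _ => τ i * lavg i f) x

/-- The local part `T^in_{τ,R} f = ∑_{Q ⊆ R} τ_Q (E_Q f) 1_Q`. -/
def TdyIn {d : ℕ} (τ : DIdx d → ℝ≥0∞) (R : DIdx d) (f : (Fin d → ℝ) → ℝ≥0∞)
    (x : Fin d → ℝ) : ℝ≥0∞ :=
  ∑' i : {i : DIdx d // dcube i ⊆ dcube R},
    (dcube i.1).indicator (fun _ => τ i.1 * lavg i.1 f) x

/-- The global part `T^out_{τ,R} f = ∑_{Q ⊇ R} τ_Q (E_Q f) 1_Q`. -/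
def TdyOut {d : ℕ} (τ : DIdx d → ℝ≥0∞) (R : DIdx d) (f : (Fin d → ℝ) → ℝ≥0∞)
    (x : Fin d → ℝ) : ℝ≥0∞ :=
  ∑' i : {i : DIdx d // dcube R ⊆ dcube i},
    (dcube i.1).indicator (fun _ => τ i.1 * lavg i.1 f) x

/-- The local testing constant `⟦σ,ω⟧^Loc_{τ,p,q}
= sup_{R : ω(R)>0} ω(R)^{-1/q'} ‖T^in_{τ,R}(1_R ω)‖_{L^{p'}(σ)}`. -/
def locTest {d : ℕ} (p q : ℝ) (τ : DIdx d → ℝ≥0∞) (σ ω : (Fin d → ℝ) → ℝ≥0∞) : ℝ≥0∞ :=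
  ⨆ (R : DIdx d) (_ : wMeasure ω (dcube R) ≠ 0),
    wMeasure ω (dcube R) ^ (-(1 / (q / (q - 1)))) *
      lpn (p / (p - 1)) (wMeasure σ) (TdyIn τ R ((dcube R).indicator ω))

/-- The global testing constant `⟦σ,ω⟧^Glo_{τ,p,q}
= sup_{R : ω(R)>0} ω(R)^{-1/q'} ‖T^out_{τ,R}(1_R ω)‖_{L^{p'}(σ)}`. -/
def gloTest {d : ℕ} (p q : ℝ) (τ : DIdx d → ℝ≥0∞) (σ ω : (Fin d → ℝ) → ℝ≥0∞) : ℝ≥0∞ :=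
  ⨆ (R : DIdx d) (_ : wMeasure ω (dcube R) ≠ 0),
    wMeasure ω (dcube R) ^ (-(1 / (q / (q - 1)))) *
      lpn (p / (p - 1)) (wMeasure σ) (TdyOut τ R ((dcube R).indicator ω))

/-- The least weak-type `L^p(σ) → L^{q,∞}(ω)` constant of `f ↦ T_τ(fσ)`. -/
def weakConst {d : ℕ} (p q : ℝ) (τ : DIdx d → ℝ≥0∞) (σ ω : (Fin d → ℝ) → ℝ≥0∞) : ℝ≥0∞ :=
  sInf {N : ℝ≥0∞ | ∀ f : (Fin d → ℝ) → ℝ≥0∞, Measurable f → lpn p (wMeasure σ) f ≠ ⊤ →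
    ∀ lam : ℝ≥0∞, 0 < lam →
      wMeasure ω {x | lam < Tdy τ (fun y => f y * σ y) x} ≤
        (N * lpn p (wMeasure σ) f / lam) ^ q}


/-- The square of the testing constant
`C_1^2 = sup_{R : σ(R)>0} σ(R)⁻¹ ∫ (∑_{Q ⊆ R} τ_Q 1_Q E_Q σ)² ω dx`. -/
def bilinC1sq {d : ℕ} (τ : DIdx d → ℝ≥0∞) (σ ω : (Fin d → ℝ) → ℝ≥0∞) : ℝ≥0∞ :=
  ⨆ (R : DIdx d) (_ : wMeasure σ (dcube R) ≠ 0),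
    (∫⁻ x, TdyIn τ R σ x ^ (2 : ℝ) ∂wMeasure ω) / wMeasure σ (dcube R)

/-- The bilinear embedding constant
`C_3 = sup { ∑_Q τ_Q E_Q(fσ) E_Q(gω) |Q| : f, g ≥ 0, ‖f‖_{L²(σ)} = ‖g‖_{L²(ω)} = 1 }`. -/
def bilinC3 {d : ℕ} (τ : DIdx d → ℝ≥0∞) (σ ω : (Fin d → ℝ) → ℝ≥0∞) : ℝ≥0∞ :=
  ⨆ (f : (Fin d → ℝ) → ℝ≥0∞) (_ : Measurable f) (_ : lpn 2 (wMeasure σ) f = 1)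
      (g : (Fin d → ℝ) → ℝ≥0∞) (_ : Measurable g) (_ : lpn 2 (wMeasure ω) g = 1),
    ∑' Q : DIdx d,
      τ Q * lavg Q (fun y => f y * σ y) * lavg Q (fun y => g y * ω y) * volume (dcube Q)

theorem ENNReal.two_mul_mul_le_sq_div_add_mul_sq (a b : ℝ≥0∞) {N : ℝ≥0∞} (h0 : N ≠ 0)
    (ht : N ≠ ⊤) : 2 * a * b ≤ a ^ 2 / N + N * b ^ 2 := by
  rcases eq_or_ne a ⊤ with rfl | ha
  · rw [ENNReal.top_pow two_ne_zero, ENNReal.top_div_of_ne_top ht]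
    simp
  rcases eq_or_ne b ⊤ with rfl | hb
  · rw [ENNReal.top_pow two_ne_zero, ENNReal.mul_top h0]
    simp
  lift a to NNReal using ha
  lift b to NNReal using hb
  lift N to NNReal using ht
  have hN : N ≠ 0 := by exact_mod_cast h0
  rw [← ENNReal.coe_pow, ← ENNReal.coe_div hN]
  norm_cast
  rw [← NNReal.coe_le_coe]
  push_cast
  have hN' : (0 : ℝ) < N := by positivity
  have : (a : ℝ) ^ 2 / N + N * b ^ 2 - 2 * a * b = (a - N * b) ^ 2 / N := by
    field_simp
    ring
  nlinarith [div_nonneg (sq_nonneg ((a : ℝ) - N * b)) hN'.le]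

/-- A finite nested family of nonempty sets has a pairwise disjoint subfamily that dominates it. -/
theorem exists_pairwiseDisjoint_dominating {ι X : Type*} (A : ι → Set X)
    (hA : ∀ i j, A i ⊆ A j ∨ A j ⊆ A i ∨ Disjoint (A i) (A j)) (P : Finset ι) :
    ∃ M ⊆ P, (M : Set ι).PairwiseDisjoint A ∧ ∀ i ∈ P, ∃ m ∈ M, A i ⊆ A m := by
  classical
  induction P using Finset.induction_on with
  | empty => exact ⟨∅, by simp⟩
  | insert i P _ ih =>
    obtain ⟨M, hMP, hdis, hdom⟩ := ih
    by_cases h : ∃ m ∈ M, A i ⊆ A m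
    · exact ⟨M, hMP.trans (Finset.subset_insert _ _), hdis, by
        simpa [Finset.forall_mem_insert] using ⟨h, hdom⟩⟩
    · push Not at h
      refine ⟨insert i (M.filter fun m => ¬ A m ⊆ A i), ?_, ?_, ?_⟩
      · exact Finset.insert_subset_insert _ ((Finset.filter_subset _ _).trans hMP)
      · rw [Finset.coe_insert, Set.pairwiseDisjoint_insert]
        refine ⟨hdis.subset fun x hx => (Finset.mem_filter.1 hx).1, fun j hj _ => ?_⟩
        simp only [Finset.coe_filter, Set.mem_ofPred_eq] at hj
        rcases hA i j with h1 | h1 | h1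
        · exact absurd h1 (h j hj.1)
        · exact absurd h1 hj.2
        · exact h1
      · intro j hj
        rcases Finset.mem_insert.1 hj with rfl | hj
        · exact ⟨j, by simp, subset_rfl⟩
        · obtain ⟨m, hm, hjm⟩ := hdom j hj
          by_cases hmi : A m ⊆ A i
          · exact ⟨i, by simp, hjm.trans hmi⟩
          · exact ⟨m, by simp [hm, hmi], hjm⟩

theorem sum_biUnion_le_sum {α β : Type*} [DecidableEq β] (M : Finset α) (s : α → Finset β)
    (t : β → ℝ≥0∞) : ∑ i ∈ M.biUnion s, t i ≤ ∑ m ∈ M, ∑ i ∈ s m, t i := by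
  classical
  induction M using Finset.induction_on with
  | empty => simp
  | insert m M hm ih =>
    rw [Finset.biUnion_insert, Finset.sum_insert hm]
    exact (le_self_add.trans_eq Finset.sum_union_inter).trans (by gcongr)

section Nested

variable {X ι : Type*} [MeasurableSpace X] {A : ι → Set X}

/-- Splitting of an integral along a finite disjoint family of measurable subsets. -/
theorem lintegral_eq_diff_add_sum {μ : Measure X} (hm : ∀ i, MeasurableSet (A i)) {B : Set X}
    {M : Finset ι} (hdis : (M : Set ι).PairwiseDisjoint A) (h : X → ℝ≥0∞) :
    ∫⁻ x in B, h x ∂μ =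
      (∫⁻ x in B \ ⋃ m ∈ M, A m, h x ∂μ) + ∑ m ∈ M, ∫⁻ x in B ∩ A m, h x ∂μ := by
  have hU : MeasurableSet (⋃ m ∈ M, A m) := M.measurableSet_biUnion fun m _ => hm m
  rw [← lintegral_inter_add_sdiff h B hU, add_comm]
  congr 1
  have h1 : B ∩ ⋃ m ∈ M, A m = (⋃ m ∈ M, A m) ∩ B := Set.inter_comm _ _
  rw [h1, ← Measure.restrict_restrict hU,
    lintegral_biUnion_finset hdis (fun m _ => hm m)]
  refine Finset.sum_congr rfl fun m _ => ?_
  rw [Measure.restrict_restrict (hm m), Set.inter_comm]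

/-- The contribution of the sets of a nested family which are not contained in any of the
stopping sets `A m`, `m ∈ M`. -/
theorem sum_mul_lintegral_le_of_not_subset {ω : Measure X}
    (hm : ∀ i, MeasurableSet (A i))
    (hA : ∀ i j, A i ⊆ A j ∨ A j ⊆ A i ∨ Disjoint (A i) (A j))
    {M L : Finset ι} {F : ι} (hdis : (M : Set ι).PairwiseDisjoint A)
    (hMF : ∀ m ∈ M, A m ⊆ A F) (hLF : ∀ i ∈ L, A i ⊆ A F)
    (hLM : ∀ i ∈ L, ∀ m ∈ M, ¬ A i ⊆ A m)
    (hω : ∀ m ∈ M, ω (A m) ≠ 0) (hω' : ∀ m ∈ M, ω (A m) ≠ ⊤)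
    {b : ι → ℝ≥0∞} {g : X → ℝ≥0∞} (hg : Measurable g) {N : ℝ≥0∞}
    (hN : N ≠ 0) (hN' : N ≠ ⊤) (x : ℝ≥0∞) :
    ∑ i ∈ L, 2 * x * b i * ∫⁻ y in A i, g y ∂ω ≤
      x ^ 2 / N * (∫⁻ y, (∑ i ∈ L, (A i).indicator (fun _ => b i) y) ^ 2 ∂ω) +
        N * ((∫⁻ y in A F \ ⋃ m ∈ M, A m, g y ^ 2 ∂ω) +
          ∑ m ∈ M, ((∫⁻ y in A m, g y ∂ω) / ω (A m)) ^ 2 * ω (A m)) := by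
  set T : X → ℝ≥0∞ := fun y => ∑ i ∈ L, (A i).indicator (fun _ => b i) y with hT
  have hTm : Measurable T :=
    Finset.measurable_sum _ fun i _ => measurable_const.indicator (hm i)
  set E : Set X := A F \ ⋃ m ∈ M, A m with hE
  have hEm : MeasurableSet E := (hm F).diff (M.measurableSet_biUnion fun m _ => hm m)
  set z : ι → ℝ≥0∞ := fun m => (∫⁻ y in A m, g y ∂ω) / ω (A m) with hz
  have hTint : ∀ (B : Set X), MeasurableSet B → ∀ (h : X → ℝ≥0∞), Measurable h →
      ∫⁻ y in B, 2 * x * T y * h y ∂ω =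
        ∑ i ∈ L, 2 * x * b i * ∫⁻ y in A i ∩ B, h y ∂ω := by
    intro B hB h hh
    have : ∀ y, 2 * x * T y * h y =
        ∑ i ∈ L, (A i).indicator (fun y => 2 * x * b i * h y) y := by
      intro y
      simp only [hT, Finset.mul_sum, Finset.sum_mul]
      refine Finset.sum_congr rfl fun i _ => ?_
      by_cases hy : y ∈ A i <;> simp [hy]
    simp_rw [this]
    rw [lintegral_finsetSum _ fun i _ => (hh.const_mul _).indicator (hm i)]
    refine Finset.sum_congr rfl fun i _ => ?_
    rw [lintegral_indicator (hm i), Measure.restrict_restrict (hm i), lintegral_const_mul _ hh]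
  have hpt : ∀ (B : Set X) (h : X → ℝ≥0∞), Measurable h →
      ∫⁻ y in B, 2 * x * T y * h y ∂ω ≤
        x ^ 2 / N * (∫⁻ y in B, T y ^ 2 ∂ω) + N * ∫⁻ y in B, h y ^ 2 ∂ω := by
    intro B h hh
    rw [← lintegral_const_mul _ (hTm.pow_const 2), ← lintegral_const_mul _ (hh.pow_const 2),
      ← lintegral_add_left ((hTm.pow_const 2).const_mul _)]
    refine lintegral_mono fun y => ?_
    have := ENNReal.two_mul_mul_le_sq_div_add_mul_sq (x * T y) (h y) hN hN'
    calc 2 * x * T y * h y = 2 * (x * T y) * h y := by ring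
      _ ≤ _ := this
      _ = _ := by rw [mul_pow, ENNReal.mul_div_right_comm]
  have hsplit : ∀ i ∈ L, ∫⁻ y in A i, g y ∂ω =
      (∫⁻ y in A i ∩ E, g y ∂ω) + ∑ m ∈ M, ∫⁻ _ in A i ∩ A m, z m ∂ω := by
    intro i hi
    rw [lintegral_eq_diff_add_sum hm hdis g]
    congr 1
    · congr 2
      ext y
      simp only [hE, Set.mem_sdiff, Set.mem_inter_iff]
      exact ⟨fun h => ⟨h.1, hLF i hi h.1, h.2⟩, fun h => ⟨h.1, h.2.2⟩⟩
    · refine Finset.sum_congr rfl fun m hmM => ?_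
      rcases hA i m with h1 | h1 | h1
      · exact absurd h1 (hLM i hi m hmM)
      · rw [Set.inter_eq_right.2 h1, setLIntegral_const, hz]
        exact (ENNReal.div_mul_cancel (hω m hmM) (hω' m hmM)).symm
      · simp [h1.inter_eq]
  calc ∑ i ∈ L, 2 * x * b i * ∫⁻ y in A i, g y ∂ω
      = (∫⁻ y in E, 2 * x * T y * g y ∂ω) +
          ∑ m ∈ M, ∫⁻ y in A m, 2 * x * T y * z m ∂ω := by
        rw [hTint E hEm g hg, Finset.sum_congr rfl fun m _ =>
          hTint (A m) (hm m) (fun _ => z m) measurable_const, Finset.sum_comm,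
          ← Finset.sum_add_distrib]
        refine Finset.sum_congr rfl fun i hi => ?_
        rw [hsplit i hi, mul_add, Finset.mul_sum]
    _ ≤ (x ^ 2 / N * (∫⁻ y in E, T y ^ 2 ∂ω) + N * ∫⁻ y in E, g y ^ 2 ∂ω) +
          ∑ m ∈ M, (x ^ 2 / N * (∫⁻ y in A m, T y ^ 2 ∂ω) + N * ∫⁻ _ in A m, z m ^ 2 ∂ω) :=
        add_le_add (hpt E g hg) (Finset.sum_le_sum fun m _ => hpt (A m) _ measurable_const)
    _ = x ^ 2 / N * ((∫⁻ y in E, T y ^ 2 ∂ω) + ∑ m ∈ M, ∫⁻ y in A F ∩ A m, T y ^ 2 ∂ω) +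
          N * ((∫⁻ y in E, g y ^ 2 ∂ω) + ∑ m ∈ M, z m ^ 2 * ω (A m)) := by
        simp only [setLIntegral_const, Finset.sum_add_distrib, ← Finset.mul_sum]
        have : ∑ m ∈ M, ∫⁻ y in A F ∩ A m, T y ^ 2 ∂ω = ∑ m ∈ M, ∫⁻ y in A m, T y ^ 2 ∂ω :=
          Finset.sum_congr rfl fun m hmM => by rw [Set.inter_eq_right.2 (hMF m hmM)]
        rw [this]
        ring
    _ = x ^ 2 / N * (∫⁻ y in A F, T y ^ 2 ∂ω) +
          N * ((∫⁻ y in E, g y ^ 2 ∂ω) + ∑ m ∈ M, z m ^ 2 * ω (A m)) := by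
        rw [lintegral_eq_diff_add_sum hm hdis (B := A F)]
    _ ≤ _ := by
        gcongr
        exact Measure.restrict_le_self

/-- If the averages of `f` at least double on the sets `A m`, then the average over `A F` is
controlled. -/
theorem six_mul_sq_average_le {σ : Measure X} (hm : ∀ i, MeasurableSet (A i))
    {M : Finset ι} {F : ι} (hdis : (M : Set ι).PairwiseDisjoint A)
    (hMF : ∀ m ∈ M, A m ⊆ A F) {f : X → ℝ≥0∞} (hf : Measurable f) {y : ι → ℝ≥0∞}
    (hy : ∀ i, i = F ∨ i ∈ M → ∫⁻ x in A i, f x ∂σ = y i * σ (A i))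
    (hyF : y F ≠ ⊤) (hσF : σ (A F) ≠ ⊤) (hyM : ∀ m ∈ M, 2 * y F ≤ y m) :
    6 * (y F ^ 2 * σ (A F)) ≤
      8 * (∫⁻ x in A F \ ⋃ m ∈ M, A m, f x ^ 2 ∂σ) + 4 * ∑ m ∈ M, y m ^ 2 * σ (A m) := by
  set E : Set X := A F \ ⋃ m ∈ M, A m with hE
  have hfin : 2 * (y F ^ 2 * σ (A F)) ≠ ⊤ := by finiteness
  rw [← ENNReal.add_le_add_iff_right hfin]
  have hpt : ∀ x, 8 * y F * f x ≤ 8 * f x ^ 2 + 2 * y F ^ 2 := by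
    intro x
    have h := ENNReal.two_mul_mul_le_sq_div_add_mul_sq (4 * y F) (f x)
      (N := 8) (by norm_num) (by norm_num)
    have h16 : (4 * y F) ^ 2 / 8 = 2 * y F ^ 2 := by
      rw [show (4 * y F) ^ 2 = 2 * y F ^ 2 * 8 by ring]
      exact ENNReal.mul_div_cancel_right (by norm_num) (by norm_num)
    rw [h16] at h
    calc 8 * y F * f x = 2 * (4 * y F) * f x := by ring
      _ ≤ _ := h
      _ = _ := add_comm _ _
  have hEint : 8 * y F * (∫⁻ x in E, f x ∂σ) ≤
      8 * (∫⁻ x in E, f x ^ 2 ∂σ) + 2 * (y F ^ 2 * σ (A F)) := by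
    rw [← lintegral_const_mul _ hf]
    refine (lintegral_mono hpt).trans ?_
    rw [lintegral_add_right _ measurable_const, lintegral_const_mul _ (hf.pow_const 2),
      setLIntegral_const, mul_assoc]
    gcongr
    exact Set.sdiff_subset
  calc 6 * (y F ^ 2 * σ (A F)) + 2 * (y F ^ 2 * σ (A F))
      = 8 * y F * (y F * σ (A F)) := by ring
    _ = 8 * y F * (∫⁻ x in E, f x ∂σ) + ∑ m ∈ M, 8 * y F * (y m * σ (A m)) := by
        rw [← hy F (Or.inl rfl), lintegral_eq_diff_add_sum hm hdis f, mul_add, Finset.mul_sum]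
        congr 1
        refine Finset.sum_congr rfl fun m hmM => ?_
        rw [Set.inter_eq_right.2 (hMF m hmM), hy m (Or.inr hmM)]
    _ ≤ (8 * (∫⁻ x in E, f x ^ 2 ∂σ) + 2 * (y F ^ 2 * σ (A F))) +
          ∑ m ∈ M, 4 * (y m ^ 2 * σ (A m)) := by
        refine add_le_add hEint (Finset.sum_le_sum fun m hmM => ?_)
        calc 8 * y F * (y m * σ (A m)) = 4 * ((2 * y F) * y m * σ (A m)) := by ring
          _ ≤ 4 * (y m * y m * σ (A m)) := by gcongr; exact hyM m hmM
          _ = _ := by ring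
    _ = _ := by rw [Finset.mul_sum]; ring

open Classical in
/-- Bilinear Carleson-type estimate below a set of a finite nested family, under a one-sided testing
condition, when the averages of `f` dominate those of `g`. -/
theorem nested_sum_below_le {σ ω : Measure X} (hm : ∀ i, MeasurableSet (A i))
    (hA : ∀ i j, A i ⊆ A j ∨ A j ⊆ A i ∨ Disjoint (A i) (A j))
    {S : Finset ι} {a y : ι → ℝ≥0∞} {f g : X → ℝ≥0∞} (hf : Measurable f) (hg : Measurable g)
    (hσ' : ∀ i ∈ S, σ (A i) ≠ ⊤)
    (hω : ∀ i ∈ S, ω (A i) ≠ 0) (hω' : ∀ i ∈ S, ω (A i) ≠ ⊤)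
    (hy' : ∀ i ∈ S, y i ≠ ⊤) (hy : ∀ i ∈ S, ∫⁻ x in A i, f x ∂σ = y i * σ (A i))
    (hdom : ∀ i ∈ S, ((∫⁻ x in A i, g x ∂ω) / ω (A i)) ^ 2 * ω (A i) ≤ y i ^ 2 * σ (A i))
    (hyA : ∀ i ∈ S, ∀ j ∈ S, A i = A j → y i = y j)
    {N : ℝ≥0∞} (hN : N ≠ 0) (hN' : N ≠ ⊤)
    (htest : ∀ R ∈ S, ∫⁻ x, (∑ i ∈ S with A i ⊆ A R,
      (A i).indicator (fun _ => a i * σ (A i)) x) ^ 2 ∂ω ≤ N ^ 2 * σ (A R))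
    {F : ι} (hF : F ∈ S) :
    (∑ i ∈ S with A i ⊆ A F, a i * (∫⁻ x in A i, f x ∂σ) * ∫⁻ x in A i, g x ∂ω) +
        5 * (N * (y F ^ 2 * σ (A F))) ≤
      N * (8 * (∫⁻ x in A F, f x ^ 2 ∂σ) + ∫⁻ x in A F, g x ^ 2 ∂ω) := by
  induction hn : (S.filter fun i => A i ⊆ A F).card using Nat.strong_induction_on
    generalizing F with
  | _ n ih =>
  set t : ι → ℝ≥0∞ := fun i => a i * (∫⁻ x in A i, f x ∂σ) * ∫⁻ x in A i, g x ∂ω with ht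
  obtain ⟨M, hMP, hdis, hMdom⟩ := exists_pairwiseDisjoint_dominating A hA
    (S.filter fun i => A i ⊆ A F ∧ 2 * y F < y i)
  have hMS : ∀ m ∈ M, m ∈ S := fun m h => (Finset.mem_filter.1 (hMP h)).1
  have hMF : ∀ m ∈ M, A m ⊆ A F := fun m h => (Finset.mem_filter.1 (hMP h)).2.1
  have hMy : ∀ m ∈ M, 2 * y F < y m := fun m h => (Finset.mem_filter.1 (hMP h)).2.2
  have hMF' : ∀ m ∈ M, ¬ A F ⊆ A m := by
    intro m h h'
    have h1 := hMy m h
    rw [hyA m (hMS m h) F hF ((hMF m h).antisymm h'), two_mul] at h1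
    exact absurd h1 (not_lt.2 le_self_add)
  set L : Finset ι := S.filter fun i => A i ⊆ A F ∧ ∀ m ∈ M, ¬ A i ⊆ A m with hL
  have hIH : ∀ m ∈ M, (∑ i ∈ S with A i ⊆ A m, t i) + 5 * (N * (y m ^ 2 * σ (A m))) ≤
      N * (8 * (∫⁻ x in A m, f x ^ 2 ∂σ) + ∫⁻ x in A m, g x ^ 2 ∂ω) := by
    intro m h
    refine ih _ ?_ (hMS m h) rfl
    rw [← hn]
    refine Finset.card_lt_card ⟨fun i hi => ?_, fun hsub => ?_⟩
    · rw [Finset.mem_filter] at hi ⊢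
      exact ⟨hi.1, hi.2.trans (hMF m h)⟩
    · exact hMF' m h (Finset.mem_filter.1 (hsub (Finset.mem_filter.2 ⟨hF, subset_rfl⟩))).2
  have hcover : ∑ i ∈ S with A i ⊆ A F, t i ≤
      ∑ i ∈ L, t i + ∑ m ∈ M, ∑ i ∈ S with A i ⊆ A m, t i := by
    have hsub : (S.filter fun i => A i ⊆ A F) ⊆
        L ∪ M.biUnion fun m => S.filter fun i => A i ⊆ A m := by
      intro i hi
      rw [Finset.mem_filter] at hi
      by_cases h : ∃ m ∈ M, A i ⊆ A m
      · obtain ⟨m, hmM, him⟩ := h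
        exact Finset.mem_union_right _
          (Finset.mem_biUnion.2 ⟨m, hmM, Finset.mem_filter.2 ⟨hi.1, him⟩⟩)
      · push Not at h
        exact Finset.mem_union_left _ (Finset.mem_filter.2 ⟨hi.1, hi.2, h⟩)
    refine (Finset.sum_le_sum_of_subset hsub).trans
      ((le_self_add.trans_eq Finset.sum_union_inter).trans ?_)
    gcongr
    exact sum_biUnion_le_sum _ _ _
  have hlocal : ∑ i ∈ L, t i ≤ N * (y F ^ 2 * σ (A F)) +
      N * ((∫⁻ x in A F \ ⋃ m ∈ M, A m, g x ^ 2 ∂ω) + ∑ m ∈ M, y m ^ 2 * σ (A m)) := by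
    have h1 : ∑ i ∈ L, t i ≤
        ∑ i ∈ L, 2 * y F * (a i * σ (A i)) * ∫⁻ x in A i, g x ∂ω := by
      refine Finset.sum_le_sum fun i hi => ?_
      obtain ⟨hiS, hiF, hiM⟩ := Finset.mem_filter.1 hi
      have hyi : y i ≤ 2 * y F := by
        by_contra! hlt
        obtain ⟨m, hmM, him⟩ := hMdom i (Finset.mem_filter.2 ⟨hiS, hiF, hlt⟩)
        exact hiM m hmM him
      rw [ht]
      dsimp only
      rw [hy i hiS]
      gcongr ?_ * _
      calc a i * (y i * σ (A i)) ≤ a i * (2 * y F * σ (A i)) := by gcongr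
        _ = _ := by ring
    refine h1.trans ((sum_mul_lintegral_le_of_not_subset hm hA hdis hMF
      (fun i hi => (Finset.mem_filter.1 hi).2.1) (fun i hi => (Finset.mem_filter.1 hi).2.2)
      (fun m h => hω m (hMS m h)) (fun m h => hω' m (hMS m h)) hg hN hN' (y F)).trans ?_)
    refine add_le_add ?_ ?_
    · calc _ ≤ y F ^ 2 / N * (N ^ 2 * σ (A F)) := by
            gcongr
            refine le_trans (lintegral_mono fun x => ?_) (htest F hF)
            gcongr
            intro i hi
            obtain ⟨hiS, hiF, -⟩ := Finset.mem_filter.1 hi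
            exact Finset.mem_filter.2 ⟨hiS, hiF⟩
        _ = (y F ^ 2 / N * N) * N * σ (A F) := by ring
        _ = _ := by rw [ENNReal.div_mul_cancel hN hN']; ring
    · exact mul_le_mul_right (add_le_add_right
        (Finset.sum_le_sum fun m hmM => hdom m (hMS m hmM)) _) _
  have havg := six_mul_sq_average_le hm hdis hMF hf (y := y)
    (fun i hi => hy i (hi.elim (fun h => h ▸ hF) (hMS i))) (hy' F hF) (hσ' F hF)
    fun m h => (hMy m h).le
  set E : Set X := A F \ ⋃ m ∈ M, A m with hE
  have hsum : ∀ (μ : Measure X) (h : X → ℝ≥0∞), ∫⁻ x in A F, h x ∂μ =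
      (∫⁻ x in E, h x ∂μ) + ∑ m ∈ M, ∫⁻ x in A m, h x ∂μ := by
    intro μ h
    rw [lintegral_eq_diff_add_sum hm hdis h]
    congr 1
    exact Finset.sum_congr rfl fun m hmM => by rw [Set.inter_eq_right.2 (hMF m hmM)]
  set Y : ℝ≥0∞ := ∑ m ∈ M, y m ^ 2 * σ (A m) with hY
  calc (∑ i ∈ S with A i ⊆ A F, t i) + 5 * (N * (y F ^ 2 * σ (A F)))
      ≤ (N * (y F ^ 2 * σ (A F)) + N * ((∫⁻ x in E, g x ^ 2 ∂ω) + Y) +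
          ∑ m ∈ M, ∑ i ∈ S with A i ⊆ A m, t i) + 5 * (N * (y F ^ 2 * σ (A F))) := by
        gcongr
        exact hcover.trans (by gcongr)
    _ = N * (6 * (y F ^ 2 * σ (A F))) + (N * ((∫⁻ x in E, g x ^ 2 ∂ω) + Y) +
          ∑ m ∈ M, ∑ i ∈ S with A i ⊆ A m, t i) := by ring
    _ ≤ N * (8 * (∫⁻ x in E, f x ^ 2 ∂σ) + 4 * Y) + (N * ((∫⁻ x in E, g x ^ 2 ∂ω) + Y) +
          ∑ m ∈ M, ∑ i ∈ S with A i ⊆ A m, t i) := by gcongr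
    _ = N * (8 * (∫⁻ x in E, f x ^ 2 ∂σ) + ∫⁻ x in E, g x ^ 2 ∂ω) +
          ∑ m ∈ M, ((∑ i ∈ S with A i ⊆ A m, t i) + 5 * (N * (y m ^ 2 * σ (A m)))) := by
        rw [Finset.sum_add_distrib, ← Finset.mul_sum, ← Finset.mul_sum]
        ring
    _ ≤ N * (8 * (∫⁻ x in E, f x ^ 2 ∂σ) + ∫⁻ x in E, g x ^ 2 ∂ω) +
          ∑ m ∈ M, N * (8 * (∫⁻ x in A m, f x ^ 2 ∂σ) + ∫⁻ x in A m, g x ^ 2 ∂ω) := by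
        gcongr with m hmM
        exact hIH m hmM
    _ = _ := by
        rw [hsum σ, hsum ω, ← Finset.mul_sum, Finset.sum_add_distrib, ← Finset.mul_sum]
        ring

open Classical in
/-- Global form of `nested_sum_below_le`. -/
theorem nested_sum_le {σ ω : Measure X} (hm : ∀ i, MeasurableSet (A i))
    (hA : ∀ i j, A i ⊆ A j ∨ A j ⊆ A i ∨ Disjoint (A i) (A j))
    {S : Finset ι} {a : ι → ℝ≥0∞} {f g : X → ℝ≥0∞} (hf : Measurable f) (hg : Measurable g)
    (hf2 : ∫⁻ x, f x ^ 2 ∂σ ≠ ⊤)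
    (hσ : ∀ i ∈ S, σ (A i) ≠ 0) (hσ' : ∀ i ∈ S, σ (A i) ≠ ⊤)
    (hω : ∀ i ∈ S, ω (A i) ≠ 0) (hω' : ∀ i ∈ S, ω (A i) ≠ ⊤)
    (hdom : ∀ i ∈ S, ((∫⁻ x in A i, g x ∂ω) / ω (A i)) ^ 2 * ω (A i) ≤
      ((∫⁻ x in A i, f x ∂σ) / σ (A i)) ^ 2 * σ (A i))
    {N : ℝ≥0∞} (hN : N ≠ 0) (hN' : N ≠ ⊤)
    (htest : ∀ R ∈ S, ∫⁻ x, (∑ i ∈ S with A i ⊆ A R,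
      (A i).indicator (fun _ => a i * σ (A i)) x) ^ 2 ∂ω ≤ N ^ 2 * σ (A R)) :
    ∑ i ∈ S, a i * (∫⁻ x in A i, f x ∂σ) * (∫⁻ x in A i, g x ∂ω) ≤
      N * (8 * (∫⁻ x, f x ^ 2 ∂σ) + ∫⁻ x, g x ^ 2 ∂ω) := by
  have hfin : ∀ i ∈ S, ∫⁻ x in A i, f x ∂σ ≠ ⊤ := by
    intro i hi
    have hle : ∫⁻ x in A i, f x ∂σ ≤ σ (A i) + ∫⁻ x, f x ^ 2 ∂σ := by
      calc ∫⁻ x in A i, f x ∂σ ≤ ∫⁻ x in A i, (1 + f x ^ 2) ∂σ := by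
            refine lintegral_mono fun x => ?_
            rcases le_total (f x) 1 with h | h
            · exact h.trans le_self_add
            · exact (le_self_pow₀ h two_ne_zero).trans le_add_self
        _ = σ (A i) + ∫⁻ x in A i, f x ^ 2 ∂σ := by
            rw [lintegral_add_left measurable_const]
            simp
        _ ≤ _ := by
            gcongr
            exact Measure.restrict_le_self
    exact ne_top_of_le_ne_top (ENNReal.add_ne_top.2 ⟨hσ' i hi, hf2⟩) hle
  obtain ⟨M, hMS, hdis, hMdom⟩ := exists_pairwiseDisjoint_dominating A hA S
  calc _ ≤ ∑ m ∈ M, ∑ i ∈ S with A i ⊆ A m,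
          a i * (∫⁻ x in A i, f x ∂σ) * (∫⁻ x in A i, g x ∂ω) := by
        refine le_trans (Finset.sum_le_sum_of_subset
          (t := M.biUnion fun m => S.filter fun i => A i ⊆ A m) fun i hi => ?_)
          (sum_biUnion_le_sum _ _ _)
        obtain ⟨m, hmM, him⟩ := hMdom i hi
        exact Finset.mem_biUnion.2 ⟨m, hmM, Finset.mem_filter.2 ⟨hi, him⟩⟩
    _ ≤ ∑ m ∈ M, N * (8 * (∫⁻ x in A m, f x ^ 2 ∂σ) + ∫⁻ x in A m, g x ^ 2 ∂ω) :=
        Finset.sum_le_sum fun m hmM => le_self_add.trans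
          (nested_sum_below_le hm hA hf hg hσ' hω hω'
            (fun i hi => ENNReal.div_ne_top (hfin i hi) (hσ i hi))
            (fun i hi => (ENNReal.div_mul_cancel (hσ i hi) (hσ' i hi)).symm) hdom
            (fun i _ j _ hij => by rw [hij]) hN hN' htest (hMS hmM))
    _ = N * (8 * (∑ m ∈ M, ∫⁻ x in A m, f x ^ 2 ∂σ) + ∑ m ∈ M, ∫⁻ x in A m, g x ^ 2 ∂ω) := by
        rw [← Finset.mul_sum, Finset.sum_add_distrib, ← Finset.mul_sum]
    _ ≤ _ := by
        rw [← lintegral_biUnion_finset hdis fun m _ => hm m,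
          ← lintegral_biUnion_finset hdis fun m _ => hm m]
        gcongr <;> exact Measure.restrict_le_self

end Nested

section Dyadic

variable {d : ℕ}

theorem dcube_eq_pi (i : DIdx d) : dcube i = Set.univ.pi fun j =>
    Set.Ico ((2 : ℝ) ^ i.1 * (i.2 j : ℝ)) ((2 : ℝ) ^ i.1 * ((i.2 j : ℝ) + 1)) := by
  ext x
  simp [dcube]

theorem measurableSet_dcube (i : DIdx d) : MeasurableSet (dcube i) := by
  rw [dcube_eq_pi]
  exact MeasurableSet.univ_pi fun _ => measurableSet_Ico

theorem volume_dcube_ne_zero (i : DIdx d) : volume (dcube i) ≠ 0 := by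
  rw [dcube_eq_pi, Real.volume_pi_Ico, Finset.prod_ne_zero_iff]
  intro j _
  rw [← mul_sub, add_sub_cancel_left, mul_one]
  simp only [ne_eq, ENNReal.ofReal_eq_zero, not_le]
  positivity

theorem volume_dcube_ne_top (i : DIdx d) : volume (dcube i) ≠ ⊤ := by
  rw [dcube_eq_pi, Real.volume_pi_Ico]
  exact ENNReal.prod_ne_top fun _ _ => ENNReal.ofReal_ne_top

theorem dcube_subset_of_le {i j : DIdx d} (hij : i.1 ≤ j.1)
    (h : (dcube i ∩ dcube j).Nonempty) : dcube i ⊆ dcube j := by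
  obtain ⟨x, hxi, hxj⟩ := h
  obtain ⟨p, hp⟩ := Int.le.dest hij
  intro y hy k
  have hpow : (2 : ℝ) ^ j.1 = 2 ^ i.1 * ((2 ^ p : ℤ) : ℝ) := by
    rw [← hp, zpow_add₀ two_ne_zero]
    simp
  have h2 : (0 : ℝ) < 2 ^ i.1 := by positivity
  obtain ⟨a1, a2⟩ := hxi k
  obtain ⟨b1, b2⟩ := hxj k
  obtain ⟨c1, c2⟩ := hy k
  rw [hpow, mul_assoc] at b1 b2
  have e1 : 2 ^ p * j.2 k < i.2 k + 1 := by
    have := lt_of_mul_lt_mul_left (b1.trans_lt a2) h2.le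
    exact_mod_cast this
  have e2 : i.2 k < 2 ^ p * (j.2 k + 1) := by
    have := lt_of_mul_lt_mul_left (a1.trans_lt b2) h2.le
    exact_mod_cast this
  have e1' : (((2 ^ p : ℤ) : ℝ) * j.2 k) ≤ i.2 k := by exact_mod_cast Int.lt_add_one_iff.1 e1
  have e2' : (i.2 k : ℝ) + 1 ≤ ((2 ^ p : ℤ) : ℝ) * (j.2 k + 1) := by exact_mod_cast e2
  rw [hpow, mul_assoc, mul_assoc]
  exact ⟨(mul_le_mul_of_nonneg_left e1' h2.le).trans c1,
    c2.trans_le (mul_le_mul_of_nonneg_left e2' h2.le)⟩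

theorem dcube_nested (i j : DIdx d) :
    dcube i ⊆ dcube j ∨ dcube j ⊆ dcube i ∨ Disjoint (dcube i) (dcube j) := by
  by_cases h : (dcube i ∩ dcube j).Nonempty
  · rcases le_total i.1 j.1 with hij | hij
    · exact Or.inl (dcube_subset_of_le hij h)
    · exact Or.inr (Or.inl (dcube_subset_of_le hij (Set.inter_comm _ _ ▸ h)))
  · exact Or.inr (Or.inr (Set.disjoint_iff_inter_eq_empty.2 (Set.not_nonempty_iff_eq_empty.1 h)))

theorem setLIntegral_wMeasure {σ f : (Fin d → ℝ) → ℝ≥0∞} (hσ : Measurable σ) (hf : Measurable f)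
    (i : DIdx d) : ∫⁻ y in dcube i, f y * σ y = ∫⁻ y in dcube i, f y ∂wMeasure σ := by
  rw [wMeasure, setLIntegral_withDensity_eq_setLIntegral_mul _ hσ hf (measurableSet_dcube i)]
  exact lintegral_congr fun y => mul_comm _ _

theorem lavg_mul_weight {σ f : (Fin d → ℝ) → ℝ≥0∞} (hσ : Measurable σ) (hf : Measurable f)
    (i : DIdx d) : lavg i (fun y => f y * σ y) =
      (∫⁻ y in dcube i, f y ∂wMeasure σ) / volume (dcube i) := by
  rw [lavg, cavg, setLIntegral_wMeasure hσ hf]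

theorem lavg_weight (σ : (Fin d → ℝ) → ℝ≥0∞) (i : DIdx d) :
    lavg i σ = wMeasure σ (dcube i) / volume (dcube i) := by
  rw [lavg, cavg, wMeasure, withDensity_apply _ (measurableSet_dcube i)]

theorem measurable_TdyIn (τ : DIdx d → ℝ≥0∞) (R : DIdx d) (f : (Fin d → ℝ) → ℝ≥0∞) :
    Measurable (TdyIn τ R f) :=
  Measurable.tsum fun i => measurable_const.indicator (measurableSet_dcube i.1)

theorem lintegral_TdyIn_mul (τ : DIdx d → ℝ≥0∞) (R : DIdx d) (h : (Fin d → ℝ) → ℝ≥0∞)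
    (μ : Measure (Fin d → ℝ)) {g : (Fin d → ℝ) → ℝ≥0∞} (hg : Measurable g) :
    ∫⁻ x, TdyIn τ R h x * g x ∂μ =
      ∑' i : {i : DIdx d // dcube i ⊆ dcube R},
        τ i.1 * lavg i.1 h * ∫⁻ x in dcube i.1, g x ∂μ := by
  have hexp : ∀ x, TdyIn τ R h x * g x = ∑' i : {i : DIdx d // dcube i ⊆ dcube R},
      (dcube i.1).indicator (fun y => τ i.1 * lavg i.1 h * g y) x := by
    intro x
    rw [TdyIn, ← ENNReal.tsum_mul_right]
    refine tsum_congr fun i => ?_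
    by_cases hx : x ∈ dcube i.1 <;> simp [hx]
  simp_rw [hexp]
  have hmeas : ∀ i : {i : DIdx d // dcube i ⊆ dcube R}, AEMeasurable
      ((dcube i.1).indicator fun y => τ i.1 * lavg i.1 h * g y) μ := fun i =>
    ((hg.const_mul _).indicator (measurableSet_dcube i.1)).aemeasurable
  rw [lintegral_tsum hmeas]
  refine tsum_congr fun i => ?_
  rw [lintegral_indicator (measurableSet_dcube i.1), lintegral_const_mul _ hg]

theorem bilinear_term_eq {τ : DIdx d → ℝ≥0∞} {σ ω f g : (Fin d → ℝ) → ℝ≥0∞} (hσ : Measurable σ)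
    (hω : Measurable ω) (hf : Measurable f) (hg : Measurable g) (Q : DIdx d) :
    τ Q * lavg Q (fun y => f y * σ y) * lavg Q (fun y => g y * ω y) * volume (dcube Q) =
      τ Q / volume (dcube Q) * (∫⁻ y in dcube Q, f y ∂wMeasure σ) *
        ∫⁻ y in dcube Q, g y ∂wMeasure ω := by
  rw [lavg_mul_weight hσ hf, lavg_mul_weight hω hg, mul_assoc, mul_assoc,
    ENNReal.div_mul_cancel (volume_dcube_ne_zero Q) (volume_dcube_ne_top Q)]
  simp only [div_eq_mul_inv]
  ring

theorem lpn_two_eq_one_iff {μ : Measure (Fin d → ℝ)} {f : (Fin d → ℝ) → ℝ≥0∞} :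
    lpn 2 μ f = 1 ↔ ∫⁻ x, f x ^ 2 ∂μ = 1 := by
  rw [lpn]
  simp only [ENNReal.rpow_two]
  have h := (ENNReal.rpow_left_injective (x := 1 / 2) (by norm_num)).eq_iff
    (a := ∫⁻ x, f x ^ 2 ∂μ) (b := 1)
  rwa [ENNReal.one_rpow] at h

/-- Interchanging the two weights does not increase the bilinear embedding constant. -/
theorem bilinC3_swap_le (τ : DIdx d → ℝ≥0∞) (σ ω : (Fin d → ℝ) → ℝ≥0∞) :
    bilinC3 τ ω σ ≤ bilinC3 τ σ ω := by
  refine iSup_le fun g => iSup_le fun hg => iSup_le fun hg1 => iSup_le fun f => iSup_le fun hf =>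
    iSup_le fun hf1 => ?_
  refine le_trans (ENNReal.tsum_le_tsum fun Q => ?_)
    (le_iSup_of_le f <| le_iSup_of_le hf <| le_iSup_of_le hf1 <| le_iSup_of_le g <|
      le_iSup_of_le hg <| le_iSup_of_le hg1 le_rfl)
  exact le_of_eq (by ring)

theorem le_bilinC3 (τ : DIdx d → ℝ≥0∞) {σ ω f g : (Fin d → ℝ) → ℝ≥0∞} (hσ : Measurable σ)
    (hω : Measurable ω) (hf : Measurable f) (hf1 : ∫⁻ x, f x ^ 2 ∂wMeasure σ = 1)
    (hg : Measurable g) (hg1 : ∫⁻ x, g x ^ 2 ∂wMeasure ω = 1) :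
    ∑' Q : DIdx d, τ Q / volume (dcube Q) * (∫⁻ y in dcube Q, f y ∂wMeasure σ) *
        (∫⁻ y in dcube Q, g y ∂wMeasure ω) ≤ bilinC3 τ σ ω := by
  refine le_trans (ENNReal.tsum_le_tsum fun Q => (bilinear_term_eq hσ hω hf hg Q).ge)
    (le_iSup_of_le f <| le_iSup_of_le hf <| le_iSup_of_le (lpn_two_eq_one_iff.2 hf1) <|
      le_iSup_of_le g <| le_iSup_of_le hg <| le_iSup_of_le (lpn_two_eq_one_iff.2 hg1) le_rfl)

/-- Duality for the `L²` norm of a nonnegative function which vanishes off a set of finite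
measure. -/
theorem lintegral_sq_le_of_forall_lintegral_mul_le {X : Type*} [MeasurableSpace X] {μ : Measure X}
    {B : Set X} (hB : μ B ≠ ⊤) (hBm : MeasurableSet B) {h : X → ℝ≥0∞} (hh : Measurable h)
    (hsupp : ∀ x, x ∉ B → h x = 0) {K : ℝ≥0∞}
    (H : ∀ g : X → ℝ≥0∞, Measurable g → ∫⁻ x, g x ^ 2 ∂μ = 1 → ∫⁻ x, h x * g x ∂μ ≤ K) :
    ∫⁻ x, h x ^ 2 ∂μ ≤ K ^ 2 := by
  have hmeas : ∀ n : ℕ, Measurable fun x => min (h x) (n : ℝ≥0∞) :=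
    fun n => hh.min measurable_const
  have hlim : ∀ x, h x ^ 2 = ⨆ n : ℕ, min (h x) (n : ℝ≥0∞) ^ 2 := by
    intro x
    have h1 : (⨆ n : ℕ, min (h x) (n : ℝ≥0∞)) = h x := by
      rw [← inf_iSup_eq, ENNReal.iSup_natCast]
      simp
    have hmono : Monotone fun n : ℕ => min (h x) (n : ℝ≥0∞) :=
      fun m n hmn => min_le_min le_rfl (by exact_mod_cast hmn)
    refine tendsto_nhds_unique (f := fun n : ℕ => min (h x) (n : ℝ≥0∞) ^ 2)
      (l := Filter.atTop) ?_ ?_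
    · have := tendsto_atTop_iSup hmono
      rw [h1] at this
      exact ((ENNReal.continuous_pow 2).tendsto _).comp this
    · exact tendsto_atTop_iSup fun m n hmn => by gcongr
  simp_rw [hlim]
  rw [lintegral_iSup (fun n => (hmeas n).pow_const 2)
    fun m n hmn x => by gcongr]
  refine iSup_le fun n => ?_
  set V : ℝ≥0∞ := ∫⁻ x, min (h x) (n : ℝ≥0∞) ^ 2 ∂μ with hV
  rcases eq_or_ne V 0 with h0 | h0
  · simp [h0]
  have hVt : V ≠ ⊤ := by
    have : V ≤ (n : ℝ≥0∞) ^ 2 * μ B := by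
      rw [← setLIntegral_const, ← lintegral_indicator hBm]
      refine lintegral_mono fun x => ?_
      by_cases hx : x ∈ B
      · simp only [Set.indicator_of_mem hx]
        gcongr
        exact min_le_right _ _
      · simp [hsupp x hx]
    exact ne_top_of_le_ne_top (ENNReal.mul_ne_top (by finiteness) hB) this
  set r : ℝ≥0∞ := V ^ (1 / 2 : ℝ) with hr
  have hr2 : r ^ 2 = V := by
    rw [hr, ← ENNReal.rpow_two, ← ENNReal.rpow_mul]
    norm_num
  have hr0 : r ≠ 0 := fun h => h0 (by rw [← hr2, h]; simp)
  have hrt : r ≠ ⊤ := fun h => hVt (by rw [← hr2, h]; simp)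
  have hg := H (fun x => min (h x) (n : ℝ≥0∞) * r⁻¹) ((hmeas n).mul_const _) (by
    simp_rw [mul_pow]
    rw [lintegral_mul_const _ ((hmeas n).pow_const 2), ← hV, ← hr2, ← mul_pow,
      ENNReal.mul_inv_cancel hr0 hrt, one_pow])
  have hrK : r ≤ K := by
    refine le_trans ?_ hg
    calc r = V * r⁻¹ := by rw [← hr2, sq, mul_assoc, ENNReal.mul_inv_cancel hr0 hrt, mul_one]
      _ = ∫⁻ x, min (h x) (n : ℝ≥0∞) ^ 2 * r⁻¹ ∂μ := by
        rw [lintegral_mul_const _ ((hmeas n).pow_const 2)]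
      _ ≤ _ := by
        refine lintegral_mono fun x => ?_
        dsimp only
        rw [sq, mul_assoc]
        gcongr
        exact min_le_left _ _
  rw [← hr2]
  gcongr

/-- The testing constant is at most the bilinear embedding constant. -/
theorem bilinC1sq_le_sq_bilinC3 (τ : DIdx d → ℝ≥0∞) {σ ω : (Fin d → ℝ) → ℝ≥0∞}
    (hσ : Measurable σ) (hω : Measurable ω) (hσt : ∀ i : DIdx d, wMeasure σ (dcube i) ≠ ⊤)
    (hωt : ∀ i : DIdx d, wMeasure ω (dcube i) ≠ ⊤) :
    bilinC1sq τ σ ω ≤ bilinC3 τ σ ω ^ 2 := by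
  refine iSup_le fun R => iSup_le fun hR => ?_
  simp only [ENNReal.rpow_two]
  set s : ℝ≥0∞ := wMeasure σ (dcube R) with hs
  set r : ℝ≥0∞ := s ^ (1 / 2 : ℝ) with hr
  have hr2 : r ^ 2 = s := by
    rw [hr, ← ENNReal.rpow_two, ← ENNReal.rpow_mul]
    norm_num
  have hr0 : r ≠ 0 := fun h => hR (by rw [← hr2, h]; simp)
  have hrt : r ≠ ⊤ := fun h => hσt R (by rw [← hs, ← hr2, h]; simp)
  rw [ENNReal.div_le_iff hR (hσt R), ← hr2, ← mul_pow]
  refine lintegral_sq_le_of_forall_lintegral_mul_le (hωt R) (measurableSet_dcube R)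
    (measurable_TdyIn τ R σ) (fun x hx => ?_) fun g hg hg1 => ?_
  · rw [TdyIn, ENNReal.tsum_eq_zero]
    exact fun i => Set.indicator_of_notMem (fun h => hx (i.2 h)) _
  set f : (Fin d → ℝ) → ℝ≥0∞ := (dcube R).indicator fun _ => r⁻¹ with hf
  have hfm : Measurable f := measurable_const.indicator (measurableSet_dcube R)
  have hf1 : ∫⁻ x, f x ^ 2 ∂wMeasure σ = 1 := by
    have : ∀ x, f x ^ 2 = (dcube R).indicator (fun _ => r⁻¹ ^ 2) x := by
      intro x
      by_cases hx : x ∈ dcube R <;> simp [hf, hx]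
    simp_rw [this]
    rw [lintegral_indicator (measurableSet_dcube R), setLIntegral_const, ← hs, ← hr2, ← mul_pow,
      ENNReal.inv_mul_cancel hr0 hrt, one_pow]
  have hfint : ∀ i : DIdx d, dcube i ⊆ dcube R →
      ∫⁻ y in dcube i, f y ∂wMeasure σ = r⁻¹ * wMeasure σ (dcube i) := by
    intro i hi
    rw [← setLIntegral_const]
    exact setLIntegral_congr_fun (measurableSet_dcube i)
      fun y hy => Set.indicator_of_mem (hi hy) _
  have hkey : r⁻¹ * ∫⁻ x, TdyIn τ R σ x * g x ∂wMeasure ω ≤ bilinC3 τ σ ω := by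
    refine le_trans ?_ (le_bilinC3 τ hσ hω hfm hf1 hg hg1)
    rw [lintegral_TdyIn_mul τ R σ _ hg, ← ENNReal.tsum_mul_left]
    refine le_trans (ENNReal.tsum_le_tsum fun i => ?_)
      (ENNReal.tsum_comp_le_tsum_of_injective (f := Subtype.val) Subtype.val_injective
        fun Q : DIdx d => τ Q / volume (dcube Q) * (∫⁻ y in dcube Q, f y ∂wMeasure σ) *
          ∫⁻ y in dcube Q, g y ∂wMeasure ω)
    rw [hfint i.1 i.2, lavg_weight]
    refine le_of_eq ?_
    simp only [div_eq_mul_inv]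
    ring
  calc _ = r⁻¹ * (∫⁻ x, TdyIn τ R σ x * g x ∂wMeasure ω) * r := by
        rw [mul_comm, ← mul_assoc, ENNReal.mul_inv_cancel hr0 hrt, one_mul]
    _ ≤ _ := by gcongr

open Classical in
/-- The testing inequality for finitely many cubes, expressed through `bilinC1sq`. -/
theorem lintegral_sum_sq_le_of_bilinC1sq_le {τ : DIdx d → ℝ≥0∞} {σ ω : (Fin d → ℝ) → ℝ≥0∞}
    {N : ℝ≥0∞} (hN : bilinC1sq τ σ ω ≤ N ^ 2) (S : Finset (DIdx d)) {R : DIdx d}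
    (hR : wMeasure σ (dcube R) ≠ 0) (hR' : wMeasure σ (dcube R) ≠ ⊤) :
    ∫⁻ x, (∑ i ∈ S with dcube i ⊆ dcube R, (dcube i).indicator
      (fun _ => τ i / volume (dcube i) * wMeasure σ (dcube i)) x) ^ 2 ∂wMeasure ω ≤
      N ^ 2 * wMeasure σ (dcube R) := by
  rw [← ENNReal.div_le_iff hR hR']
  refine le_trans (ENNReal.div_le_div_right (lintegral_mono fun x => ?_) _)
    ((le_iSup₂_of_le R hR le_rfl : _ ≤ bilinC1sq τ σ ω).trans hN)
  rw [ENNReal.rpow_two]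
  gcongr
  set F : DIdx d → ℝ≥0∞ := fun i => (dcube i).indicator (fun _ => τ i * lavg i σ) x with hF
  have h1 : TdyIn τ R σ x = ∑' i, {i : DIdx d | dcube i ⊆ dcube R}.indicator F i :=
    tsum_subtype {i : DIdx d | dcube i ⊆ dcube R} F
  rw [h1, Finset.sum_filter]
  refine le_trans (Finset.sum_le_sum fun i _ => ?_)
    (ENNReal.sum_le_tsum (f := {i : DIdx d | dcube i ⊆ dcube R}.indicator F) S)
  by_cases hi : dcube i ⊆ dcube R
  · rw [if_pos hi, Set.indicator_of_mem (show i ∈ {i : DIdx d | dcube i ⊆ dcube R} from hi), hF]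
    dsimp only
    rw [lavg_weight]
    refine le_of_eq (congrArg (fun c => (dcube i).indicator (fun _ => c) x) ?_)
    simp only [div_eq_mul_inv]
    ring
  · simp [hi]

/-- The bilinear embedding constant is controlled by any common bound on the testing constants. -/
theorem bilinC3_le_of_bilinC1sq_le {τ : DIdx d → ℝ≥0∞} {σ ω : (Fin d → ℝ) → ℝ≥0∞}
    (hσ : Measurable σ) (hω : Measurable ω) (hσt : ∀ i : DIdx d, wMeasure σ (dcube i) ≠ ⊤)
    (hωt : ∀ i : DIdx d, wMeasure ω (dcube i) ≠ ⊤) {N : ℝ≥0∞} (hN0 : N ≠ 0) (hNt : N ≠ ⊤)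
    (h1 : bilinC1sq τ σ ω ≤ N ^ 2) (h2 : bilinC1sq τ ω σ ≤ N ^ 2) :
    bilinC3 τ σ ω ≤ 18 * N := by
  classical
  refine iSup_le fun f => iSup_le fun hf => iSup_le fun hf1 => iSup_le fun g => iSup_le fun hg =>
    iSup_le fun hg1 => ?_
  rw [lpn_two_eq_one_iff] at hf1 hg1
  simp_rw [bilinear_term_eq hσ hω hf hg]
  rw [ENNReal.tsum_eq_iSup_sum]
  refine iSup_le fun s => ?_
  set S := s.filter fun i => wMeasure σ (dcube i) ≠ 0 ∧ wMeasure ω (dcube i) ≠ 0 with hS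
  have hSs : ∀ i ∈ S, wMeasure σ (dcube i) ≠ 0 := fun i hi => (Finset.mem_filter.1 hi).2.1
  have hSw : ∀ i ∈ S, wMeasure ω (dcube i) ≠ 0 := fun i hi => (Finset.mem_filter.1 hi).2.2
  set P : DIdx d → Prop := fun i =>
    ((∫⁻ x in dcube i, g x ∂wMeasure ω) / wMeasure ω (dcube i)) ^ 2 * wMeasure ω (dcube i) ≤
      ((∫⁻ x in dcube i, f x ∂wMeasure σ) / wMeasure σ (dcube i)) ^ 2 * wMeasure σ (dcube i)
    with hP
  have hA := nested_sum_le (σ := wMeasure σ) (ω := wMeasure ω) measurableSet_dcube dcube_nested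
    (S := S.filter P) (a := fun i => τ i / volume (dcube i)) hf hg (by rw [hf1]; simp)
    (fun i hi => hSs i (Finset.mem_filter.1 hi).1) (fun i _ => hσt i)
    (fun i hi => hSw i (Finset.mem_filter.1 hi).1) (fun i _ => hωt i)
    (fun i hi => (Finset.mem_filter.1 hi).2) hN0 hNt
    (fun R hR => lintegral_sum_sq_le_of_bilinC1sq_le h1 _
      (hSs R (Finset.mem_filter.1 hR).1) (hσt R))
  have hB := nested_sum_le (σ := wMeasure ω) (ω := wMeasure σ) measurableSet_dcube dcube_nested
    (S := S.filter fun i => ¬ P i) (a := fun i => τ i / volume (dcube i)) hg hf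
    (by rw [hg1]; simp)
    (fun i hi => hSw i (Finset.mem_filter.1 hi).1) (fun i _ => hωt i)
    (fun i hi => hSs i (Finset.mem_filter.1 hi).1) (fun i _ => hσt i)
    (fun i hi => (not_le.1 (Finset.mem_filter.1 hi).2).le) hN0 hNt
    (fun R hR => lintegral_sum_sq_le_of_bilinC1sq_le h2 _
      (hSw R (Finset.mem_filter.1 hR).1) (hωt R))
  rw [hf1, hg1] at hA hB
  have hred : ∑ i ∈ s, τ i / volume (dcube i) * (∫⁻ y in dcube i, f y ∂wMeasure σ) *
      (∫⁻ y in dcube i, g y ∂wMeasure ω) =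
      ∑ i ∈ S, τ i / volume (dcube i) * (∫⁻ y in dcube i, f y ∂wMeasure σ) *
      (∫⁻ y in dcube i, g y ∂wMeasure ω) := by
    refine (Finset.sum_filter_of_ne fun i _ hne => ⟨fun h => hne ?_, fun h => hne ?_⟩).symm
    · rw [setLIntegral_measure_zero _ _ h]
      simp
    · rw [setLIntegral_measure_zero _ _ h]
      simp
  rw [hred, ← Finset.sum_filter_add_sum_filter_not S P]
  calc _ ≤ N * (8 * 1 + 1) + N * (8 * 1 + 1) := by
        refine add_le_add hA (le_trans (le_of_eq ?_) hB)
        exact Finset.sum_congr rfl fun i _ => by ring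
    _ = 18 * N := by ring

end Dyadic

theorem stmt3 (d : ℕ) :
    ∃ c C : ℝ≥0∞, 0 < c ∧ c < ⊤ ∧ 0 < C ∧ C < ⊤ ∧
      ∀ (τ : DIdx d → ℝ≥0∞) (σ ω : (Fin d → ℝ) → ℝ≥0∞),
        Measurable σ → Measurable ω →
        (∀ i : DIdx d, wMeasure σ (dcube i) ≠ ⊤) →
        (∀ i : DIdx d, wMeasure ω (dcube i) ≠ ⊤) →
        c * (bilinC1sq τ σ ω ^ (1 / 2 : ℝ) + bilinC1sq τ ω σ ^ (1 / 2 : ℝ)) ≤ bilinC3 τ σ ω ∧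
          bilinC3 τ σ ω ≤
            C * (bilinC1sq τ σ ω ^ (1 / 2 : ℝ) + bilinC1sq τ ω σ ^ (1 / 2 : ℝ)) := by
  refine ⟨2⁻¹, 18, by simp, by simp, by simp, by simp, fun τ σ ω hσ hω hσt hωt => ⟨?_, ?_⟩⟩
  · have hroot : ∀ {a b : ℝ≥0∞}, a ≤ b ^ 2 → a ^ (1 / 2 : ℝ) ≤ b := by
      intro a b h
      refine (ENNReal.rpow_le_rpow h (by norm_num)).trans_eq ?_
      rw [← ENNReal.rpow_two, ← ENNReal.rpow_mul]
      norm_num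
    have h1 := hroot (bilinC1sq_le_sq_bilinC3 τ hσ hω hσt hωt)
    have h2 := (hroot (bilinC1sq_le_sq_bilinC3 τ hω hσ hωt hσt)).trans (bilinC3_swap_le τ σ ω)
    calc _ ≤ 2⁻¹ * (bilinC3 τ σ ω + bilinC3 τ σ ω) := by gcongr
      _ = bilinC3 τ σ ω := by
        rw [← two_mul, ← mul_assoc, ENNReal.inv_mul_cancel two_ne_zero ENNReal.ofNat_ne_top,
          one_mul]
  · rw [mul_comm, ← ENNReal.div_le_iff (by norm_num) (by norm_num)]
    refine le_of_forall_gt_imp_ge_of_dense fun N hN => ?_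
    rw [ENNReal.div_le_iff (by norm_num) (by norm_num), mul_comm]
    rcases eq_or_ne N ⊤ with rfl | hNt
    · simp
    have hsq : ∀ {a : ℝ≥0∞}, a ^ (1 / 2 : ℝ) ≤ N → a ≤ N ^ 2 := by
      intro a h
      have := pow_le_pow_left' h 2
      rwa [← ENNReal.rpow_two, ← ENNReal.rpow_mul, one_div_mul_cancel two_ne_zero,
        ENNReal.rpow_one] at this
    exact bilinC3_le_of_bilinC1sq_le hσ hω hσt hωt (ne_bot_of_gt hN) hNt
      (hsq (le_self_add.trans hN.le)) (hsq (le_add_self.trans hN.le))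
end
end

section
/- (Weak-type characterization by local testing.) Let 1 < p ≤ q < ∞, let τ = (τ_Q)_{Q∈𝒬} be nonnegative constants, and let σ, ω be weights on ℝ^d. Let 𝔑 be the least constant N ∈ [0,∞] such that ω({x : T_τ(fσ)(x) > λ}) ≤ (N ‖f‖_{L^p(σ)} / λ)^q for all λ > 0 and all nonnegative f ∈ L^p(σ), and let 𝔏 = ⟦σ,ω⟧^Loc_{τ,p,q} be the local testing constant. Then there are constants c, C > 0 depending only on p, q, d such that c·𝔏 ≤ 𝔑 ≤ C·𝔏, both sides understood in [0,∞]. -/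
open MeasureTheory ENNReal

noncomputable section

section General

variable {X : Type*} [MeasurableSpace X]

/-- A function whose pairings with `L^p` are bounded by `K` has `L^{p'}` norm at most `K`. -/
theorem lintegral_rpow_conj_le_of_pairing {p p' : ℝ} (hp : p.HolderConjugate p')
    {μ : Measure X} {g : X → ℝ≥0∞} (hg : Measurable g) {R : Set X} (hR : MeasurableSet R)
    (hμR : μ R ≠ ⊤) (hgR : ∀ x ∉ R, g x = 0) {K : ℝ≥0∞}
    (hK : ∀ f : X → ℝ≥0∞, Measurable f → ∫⁻ x, f x ^ p ∂μ ≠ ⊤ →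
      ∫⁻ x, g x * f x ∂μ ≤ K * (∫⁻ x, f x ^ p ∂μ) ^ (1 / p)) :
    (∫⁻ x, g x ^ p' ∂μ) ^ (1 / p') ≤ K := by
  have hp0 := hp.pos
  have hp'0 := hp.symm.pos
  have hp'1 := hp.symm.lt
  have key : ∀ n : ℕ, ∫⁻ x, (min (g x) n) ^ p' ∂μ ≤ K ^ p' := by
    intro n
    have hm : Measurable fun x => min (g x) (n : ℝ≥0∞) := hg.min measurable_const
    have hfp : ∀ x, ((min (g x) (n : ℝ≥0∞)) ^ (p' - 1)) ^ p = (min (g x) n) ^ p' := by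
      intro x
      rw [← ENNReal.rpow_mul, hp.symm.sub_one_mul_conj]
    have hfin : ∫⁻ x, (min (g x) (n : ℝ≥0∞)) ^ p' ∂μ ≠ ⊤ := by
      refine ne_top_of_le_ne_top (b := (n : ℝ≥0∞) ^ p' * μ R) ?_ ?_
      · exact ENNReal.mul_ne_top (ENNReal.rpow_ne_top_of_nonneg hp'0.le (by simp)) hμR
      · rw [← lintegral_indicator_const hR]
        refine lintegral_mono fun x => ?_
        by_cases hx : x ∈ R
        · simp only [hx, Set.indicator_of_mem]
          exact ENNReal.rpow_le_rpow (min_le_right _ _) hp'0.le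
        · simp [hgR x hx, hp'0]
    have h1 := hK (fun x => (min (g x) n) ^ (p' - 1)) (hm.pow_const _) (by simpa [hfp] using hfin)
    simp only [hfp] at h1
    have h2 : ∫⁻ x, (min (g x) (n : ℝ≥0∞)) ^ p' ∂μ ≤
        K * (∫⁻ x, (min (g x) (n : ℝ≥0∞)) ^ p' ∂μ) ^ (1 / p) := by
      refine le_trans (lintegral_mono fun x => ?_) h1
      calc (min (g x) (n : ℝ≥0∞)) ^ p' = (min (g x) (n : ℝ≥0∞)) ^ (1 + (p' - 1)) := by ring_nf
        _ = min (g x) (n : ℝ≥0∞) * (min (g x) (n : ℝ≥0∞)) ^ (p' - 1) := by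
            rw [ENNReal.rpow_add_of_nonneg _ _ zero_le_one (by linarith), ENNReal.rpow_one]
        _ ≤ _ := by gcongr; exact min_le_left _ _
    set I := ∫⁻ x, (min (g x) (n : ℝ≥0∞)) ^ p' ∂μ
    rcases eq_or_ne I 0 with h0 | h0
    · rw [h0]; exact zero_le
    have hsplit : I = I ^ (1 / p') * I ^ (1 / p) := by
      rw [← ENNReal.rpow_add _ _ h0 hfin, one_div, one_div, add_comm, hp.inv_add_inv_eq_one,
        ENNReal.rpow_one]
    have h3 : I ^ (1 / p') * I ^ (1 / p) ≤ K * I ^ (1 / p) := hsplit ▸ h2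
    have h4 : I ^ (1 / p') ≤ K := by
      refine (ENNReal.mul_le_mul_iff_left ?_ ?_).1 h3
      · simp [ENNReal.rpow_eq_zero_iff, h0, hfin]
      · exact ENNReal.rpow_ne_top_of_nonneg (by positivity) hfin
    calc I = (I ^ (1 / p')) ^ p' := by
          rw [← ENNReal.rpow_mul, one_div_mul_cancel hp'0.ne', ENNReal.rpow_one]
      _ ≤ K ^ p' := ENNReal.rpow_le_rpow h4 hp'0.le
  have hsup : ∫⁻ x, g x ^ p' ∂μ = ⨆ n : ℕ, ∫⁻ x, (min (g x) n) ^ p' ∂μ := by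
    rw [← lintegral_iSup]
    · refine lintegral_congr fun x => ?_
      have : g x = ⨆ n : ℕ, min (g x) (n : ℝ≥0∞) := by
        rw [← inf_iSup_eq, ENNReal.iSup_natCast, inf_top_eq]
      conv_lhs => rw [this]
      exact (ENNReal.orderIsoRpow p' hp'0).map_iSup _
    · exact fun n => (hg.min measurable_const).pow_const _
    · intro m n hmn x
      exact ENNReal.rpow_le_rpow (min_le_min le_rfl (by exact_mod_cast hmn)) hp'0.le
  rw [one_div, ENNReal.rpow_inv_le_iff hp'0, hsup]
  exact iSup_le key

/-- The constant in the embedding of weak `L^q` into `L^1` on sets of finite measure. -/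
def weakEmbConst (q : ℝ) : ℝ≥0∞ := 1 + ∑' k : ℕ, ((2 : ℝ≥0∞) ^ (1 - q)) ^ k

theorem weakEmbConst_ne_top {q : ℝ} (hq : 1 < q) : weakEmbConst q ≠ ⊤ := by
  have h : (2 : ℝ≥0∞) ^ (1 - q) < 1 :=
    ENNReal.rpow_lt_one_of_one_lt_of_neg (by norm_num) (by linarith)
  simp only [weakEmbConst, ENNReal.tsum_geometric, ne_eq, ENNReal.add_eq_top, ENNReal.one_ne_top,
    false_or, ENNReal.inv_eq_top, tsub_eq_zero_iff_le, not_le]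
  exact h

theorem one_le_weakEmbConst (q : ℝ) : 1 ≤ weakEmbConst q := le_self_add

theorem le_add_tsum_pow_two {a : ℝ≥0∞} (ha : 0 < a) (y : ℝ≥0∞) :
    y ≤ a + ∑' k : ℕ, if 2 ^ k * a < y then 2 ^ k * a else 0 := by
  have hstep : ∀ n : ℕ, (∀ k < n, 2 ^ k * a < y) →
      2 ^ n * a ≤ a + ∑' k : ℕ, if 2 ^ k * a < y then 2 ^ k * a else 0 := by
    intro n hn
    have h1 : ∑ k ∈ Finset.range n, (if 2 ^ k * a < y then 2 ^ k * a else 0) =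
        ∑ k ∈ Finset.range n, 2 ^ k * a :=
      Finset.sum_congr rfl fun k hk => if_pos (hn k (Finset.mem_range.1 hk))
    have h2 : ∀ m : ℕ, a + ∑ k ∈ Finset.range m, 2 ^ k * a = 2 ^ m * a := by
      intro m
      induction m with
      | zero => simp
      | succ m ih => rw [Finset.sum_range_succ, ← add_assoc, ih]; ring
    rw [← h2 n, ← h1]
    gcongr
    exact ENNReal.sum_le_tsum _
  by_cases h : ∃ n : ℕ, y ≤ 2 ^ n * a
  · classical
    refine (Nat.find_spec h).trans (hstep _ fun k hk => ?_)
    exact not_le.1 (Nat.find_min h hk)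
  · push Not at h
    have : ∀ n : ℕ, (n : ℝ≥0∞) * a ≤
        a + ∑' k : ℕ, if 2 ^ k * a < y then 2 ^ k * a else 0 := fun n => by
      refine le_trans ?_ (hstep n fun k _ => h k)
      gcongr
      exact_mod_cast Nat.lt_two_pow_self.le
    have h3 := iSup_le this
    rw [← ENNReal.iSup_mul, ENNReal.iSup_natCast, ENNReal.top_mul ha.ne', top_le_iff] at h3
    rw [h3]; exact le_top

theorem setLIntegral_le_of_weak {q : ℝ} (hq : 1 < q) {μ : Measure X} {R : Set X}
    (h0 : μ R ≠ 0) (hR : μ R ≠ ⊤) {F : X → ℝ≥0∞} (hF : Measurable F)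
    {M : ℝ≥0∞} (hM : M ≠ ⊤)
    (hw : ∀ lam : ℝ≥0∞, 0 < lam → μ {x | lam < F x} ≤ (M / lam) ^ q) :
    ∫⁻ x in R, F x ∂μ ≤ weakEmbConst q * M * μ R ^ (1 - 1 / q) := by
  have hq0 : 0 < q := by linarith
  have hpos : ∀ M' : ℝ≥0∞, 0 < M' → M' ≠ ⊤ → M ≤ M' →
      ∫⁻ x in R, F x ∂μ ≤ weakEmbConst q * M' * μ R ^ (1 - 1 / q) := by
    intro M' hM0 hMt hMM'
    set a := M' * μ R ^ (-(1 / q)) with ha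
    have hr0 : μ R ^ (-(1 / q)) ≠ 0 := by simp [ENNReal.rpow_eq_zero_iff, h0, hR]
    have hrt : μ R ^ (-(1 / q)) ≠ ⊤ := by simp [ENNReal.rpow_eq_top_iff, h0, hR]
    have ha0 : 0 < a := ENNReal.mul_pos hM0.ne' hr0
    have hat : a ≠ ⊤ := ENNReal.mul_ne_top hMt hrt
    have haq : a * μ R = M' * μ R ^ (1 - 1 / q) := by
      rw [ha, mul_assoc, sub_eq_neg_add, ENNReal.rpow_add _ _ h0 hR, ENNReal.rpow_one]
    have hMa : (M' / a) ^ q = μ R := by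
      rw [ha, ENNReal.rpow_neg]
      rw [ENNReal.div_eq_inv_mul, ENNReal.mul_inv (Or.inl hM0.ne') (Or.inl hMt), inv_inv,
        mul_right_comm, ENNReal.inv_mul_cancel hM0.ne' hMt, one_mul, ← ENNReal.rpow_mul,
        one_div_mul_cancel hq0.ne', ENNReal.rpow_one]
    calc ∫⁻ x in R, F x ∂μ
        ≤ ∫⁻ x in R, (a + ∑' k : ℕ, {x | 2 ^ k * a < F x}.indicator (fun _ => 2 ^ k * a) x) ∂μ := by
          refine lintegral_mono fun x => ?_
          simpa [Set.indicator_apply] using le_add_tsum_pow_two ha0 (F x)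
      _ = a * μ R + ∑' k : ℕ, 2 ^ k * a * (μ.restrict R) {x | 2 ^ k * a < F x} := by
          rw [lintegral_add_left measurable_const, setLIntegral_const, lintegral_tsum]
          · congr 1
            refine tsum_congr fun k => ?_
            rw [lintegral_indicator_const (measurableSet_lt measurable_const hF)]
          · exact fun k => (measurable_const.indicator
              (measurableSet_lt measurable_const hF)).aemeasurable
      _ ≤ a * μ R + ∑' k : ℕ, a * μ R * (2 ^ (1 - q)) ^ k := by
          refine add_le_add le_rfl (ENNReal.tsum_le_tsum fun k => ?_)
          have h1 : (μ.restrict R) {x | 2 ^ k * a < F x} ≤ (M' / (2 ^ k * a)) ^ q := by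
            refine (Measure.restrict_apply_le _ _).trans ((hw _ ?_).trans ?_)
            · exact ENNReal.mul_pos (by simp) ha0.ne'
            · gcongr
          have h2 : (M' / (2 ^ k * a)) ^ q = μ R * ((2 : ℝ≥0∞) ^ (-q)) ^ k := by
            rw [← hMa, div_eq_mul_inv, ENNReal.mul_inv (Or.inl (by simp))
              (Or.inl (by simp)), mul_left_comm, ← div_eq_mul_inv,
              ENNReal.mul_rpow_of_nonneg _ _ hq0.le, mul_comm]
            congr 1
            rw [← ENNReal.rpow_natCast, ← ENNReal.rpow_natCast, ← ENNReal.rpow_neg,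
              ← ENNReal.rpow_mul, ← ENNReal.rpow_mul]
            ring_nf
          calc 2 ^ k * a * (μ.restrict R) {x | 2 ^ k * a < F x}
              ≤ 2 ^ k * a * (μ R * ((2 : ℝ≥0∞) ^ (-q)) ^ k) := by rw [← h2]; gcongr
            _ = a * μ R * (2 * (2 : ℝ≥0∞) ^ (-q)) ^ k := by rw [mul_pow]; ring
            _ = a * μ R * (2 ^ (1 - q)) ^ k := by
                rw [sub_eq_add_neg, ENNReal.rpow_add _ _ (by simp) (by simp), ENNReal.rpow_one]
      _ = weakEmbConst q * M' * μ R ^ (1 - 1 / q) := by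
          rw [ENNReal.tsum_mul_left, haq, weakEmbConst]; ring
  have hlim : Filter.Tendsto (fun e : ℝ≥0∞ => weakEmbConst q * (M + e) * μ R ^ (1 - 1 / q))
      (nhdsWithin 0 (Set.Ioi 0)) (nhds (weakEmbConst q * (M + 0) * μ R ^ (1 - 1 / q))) := by
    have hrt : μ R ^ (1 - 1 / q) ≠ ⊤ := by simp [ENNReal.rpow_eq_top_iff, h0, hR]
    refine (ENNReal.Tendsto.mul_const (ENNReal.Tendsto.const_mul ?_
      (Or.inr (weakEmbConst_ne_top hq))) (Or.inr hrt))
    exact (tendsto_const_nhds.add Filter.tendsto_id).mono_left nhdsWithin_le_nhds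
  rw [add_zero] at hlim
  refine ge_of_tendsto hlim ?_
  filter_upwards [self_mem_nhdsWithin, nhdsWithin_le_nhds (Iio_mem_nhds ENNReal.zero_lt_top)]
    with e he he'
  exact hpos _ (lt_of_lt_of_le he le_add_self) (ENNReal.add_ne_top.2 ⟨hM, he'.ne⟩) le_self_add

theorem sum_rpow_le_rpow_sum {κ : Type*} (s : Finset κ) (a : κ → ℝ≥0∞) {r : ℝ} (hr : 1 ≤ r) :
    ∑ i ∈ s, a i ^ r ≤ (∑ i ∈ s, a i) ^ r := by
  classical
  induction s using Finset.induction_on with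
  | empty => simp
  | insert i s hi ih =>
    rw [Finset.sum_insert hi, Finset.sum_insert hi]
    exact (add_le_add le_rfl ih).trans (ENNReal.add_rpow_le_rpow_add _ _ hr)

variable {ι : Type*}

/-- The positive operator `f ↦ ∑ i, κ i (∫_{D i} f dμ) 1_{D i}`. -/
def posOp (κ : ι → ℝ≥0∞) (D : ι → Set X) (μ : Measure X) (f : X → ℝ≥0∞) (x : X) : ℝ≥0∞ :=
  ∑' i, (D i).indicator (fun _ => κ i * ∫⁻ y in D i, f y ∂μ) x

open Classical in
/-- The coefficients `κ i` restricted to those `i` with `D i ⊆ R`. -/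
def locCoef (κ : ι → ℝ≥0∞) (D : ι → Set X) (R : Set X) (i : ι) : ℝ≥0∞ :=
  if D i ⊆ R then κ i else 0

theorem locCoef_le {Y : Type*} (κ : ι → ℝ≥0∞) (D : ι → Set Y) (R : Set Y) (i : ι) :
    locCoef κ D R i ≤ κ i := by
  unfold locCoef; split_ifs <;> simp

theorem locCoef_mono {Y : Type*} {κ κ' : ι → ℝ≥0∞} (h : κ ≤ κ') (D : ι → Set Y) (R : Set Y) :
    locCoef κ D R ≤ locCoef κ' D R := by
  intro i
  unfold locCoef; split_ifs
  · exact h i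
  · exact le_rfl

theorem posOp_mono {κ κ' : ι → ℝ≥0∞} (h : κ ≤ κ') (D : ι → Set X) (μ : Measure X)
    (f : X → ℝ≥0∞) (x : X) : posOp κ D μ f x ≤ posOp κ' D μ f x := by
  refine ENNReal.tsum_le_tsum fun i => Set.indicator_le_indicator ?_
  gcongr; exact h i

theorem posOp_locCoef_of_notMem (κ : ι → ℝ≥0∞) (D : ι → Set X) (μ : Measure X)
    (f : X → ℝ≥0∞) {R : Set X} {x : X} (hx : x ∉ R) : posOp (locCoef κ D R) D μ f x = 0 := by
  refine ENNReal.tsum_eq_zero.2 fun i => ?_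
  by_cases h : D i ⊆ R
  · exact Set.indicator_of_notMem (fun hi => hx (h hi)) _
  · simp [locCoef, h]

section Countable

variable [Countable ι]

theorem measurable_posOp (κ : ι → ℝ≥0∞) {D : ι → Set X} (hD : ∀ i, MeasurableSet (D i))
    (μ : Measure X) (f : X → ℝ≥0∞) : Measurable (posOp κ D μ f) :=
  Measurable.tsum fun i => measurable_const.indicator (hD i)

theorem lintegral_mul_posOp (κ : ι → ℝ≥0∞) {D : ι → Set X} (hD : ∀ i, MeasurableSet (D i))
    (μ ν : Measure X) (f : X → ℝ≥0∞) {g : X → ℝ≥0∞} (hg : Measurable g) :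
    ∫⁻ x, g x * posOp κ D μ f x ∂ν =
      ∑' i, κ i * (∫⁻ y in D i, f y ∂μ) * ∫⁻ y in D i, g y ∂ν := by
  simp only [posOp, ← ENNReal.tsum_mul_left]
  refine (lintegral_tsum fun i =>
    (hg.mul (measurable_const.indicator (hD i))).aemeasurable).trans (tsum_congr fun i => ?_)
  rw [Pi.mul_def, ← lintegral_const_mul _ hg,
    ← lintegral_indicator (hD i) (fun x => (κ i * ∫⁻ y in D i, f y ∂μ) * g x)]
  refine lintegral_congr fun x => ?_
  by_cases hx : x ∈ D i <;> simp [hx, mul_comm]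

theorem lintegral_mul_posOp_comm (κ : ι → ℝ≥0∞) {D : ι → Set X} (hD : ∀ i, MeasurableSet (D i))
    (μ ν : Measure X) {f g : X → ℝ≥0∞} (hf : Measurable f) (hg : Measurable g) :
    ∫⁻ x, g x * posOp κ D μ f x ∂ν = ∫⁻ x, f x * posOp κ D ν g x ∂μ := by
  rw [lintegral_mul_posOp κ hD μ ν f hg, lintegral_mul_posOp κ hD ν μ g hf]
  exact tsum_congr fun i => by ring

/-- Pairing of the local operator with `ω` over `R`, moved to the dual side. -/
theorem setLIntegral_posOp_locCoef (κ : ι → ℝ≥0∞) {D : ι → Set X}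
    (hD : ∀ i, MeasurableSet (D i)) (σ ω : Measure X) {f : X → ℝ≥0∞} (hf : Measurable f)
    {R : Set X} (hR : MeasurableSet R) :
    ∫⁻ x in R, posOp (locCoef κ D R) D σ f x ∂ω =
      ∫⁻ x, posOp (locCoef κ D R) D ω 1 x * f x ∂σ := by
  have h := lintegral_mul_posOp_comm (locCoef κ D R) hD σ ω hf (g := 1) measurable_one
  simp only [Pi.one_apply, one_mul] at h
  rw [← lintegral_indicator hR]
  simp only [mul_comm (posOp _ _ _ _ _) (f _)]
  rw [← h]
  refine lintegral_congr fun x => ?_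
  by_cases hx : x ∈ R
  · simp [hx]
  · simp [hx, posOp_locCoef_of_notMem κ D σ f hx]

/-- A weak-type inequality implies the local testing inequality on the dual side. -/
theorem testing_of_weak {p p' q : ℝ} (hp : p.HolderConjugate p') (hq : 1 < q)
    (κ : ι → ℝ≥0∞) {D : ι → Set X} (hD : ∀ i, MeasurableSet (D i)) (σ ω : Measure X)
    {N : ℝ≥0∞} (hN : N ≠ ⊤)
    (hw : ∀ f : X → ℝ≥0∞, Measurable f → ∫⁻ x, f x ^ p ∂σ ≠ ⊤ → ∀ lam : ℝ≥0∞, 0 < lam →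
      ω {x | lam < posOp κ D σ f x} ≤ (N * (∫⁻ x, f x ^ p ∂σ) ^ (1 / p) / lam) ^ q)
    {R : Set X} (hR : MeasurableSet R) (hσR : σ R ≠ ⊤) (hωR : ω R ≠ ⊤) (h0 : ω R ≠ 0) :
    (∫⁻ x, posOp (locCoef κ D R) D ω 1 x ^ p' ∂σ) ^ (1 / p') ≤
      weakEmbConst q * N * ω R ^ (1 - 1 / q) := by
  refine lintegral_rpow_conj_le_of_pairing hp (measurable_posOp _ hD _ _) hR hσR
    (fun x hx => posOp_locCoef_of_notMem κ D ω 1 hx) fun f hf hfp => ?_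
  rw [← setLIntegral_posOp_locCoef κ hD σ ω hf hR]
  calc ∫⁻ x in R, posOp (locCoef κ D R) D σ f x ∂ω
      ≤ ∫⁻ x in R, posOp κ D σ f x ∂ω :=
        lintegral_mono fun x => posOp_mono (locCoef_le κ D R) D σ f x
    _ ≤ weakEmbConst q * (N * (∫⁻ x, f x ^ p ∂σ) ^ (1 / p)) * ω R ^ (1 - 1 / q) := by
        refine setLIntegral_le_of_weak hq h0 hωR (measurable_posOp _ hD _ _) ?_ (hw f hf hfp)
        exact ENNReal.mul_ne_top hN
          (ENNReal.rpow_ne_top_of_nonneg (one_div_nonneg.2 hp.nonneg) hfp)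
    _ = _ := by ring

end Countable

/-- The part of `posOp` coming from the sets that contain `D i`. -/
def outSum (κ : ι → ℝ≥0∞) (D : ι → Set X) (μ : Measure X) (f : X → ℝ≥0∞) (i : ι) : ℝ≥0∞ :=
  ∑' j, {j | D i ⊆ D j}.indicator (fun j => κ j * ∫⁻ y in D j, f y ∂μ) j

/-- Two sets are nested or disjoint, as for dyadic cubes. -/
def NestedFamily (D : ι → Set X) : Prop :=
  ∀ i j, D i ⊆ D j ∨ D j ⊆ D i ∨ Disjoint (D i) (D j)

theorem outSum_le_posOp (κ : ι → ℝ≥0∞) (D : ι → Set X) (μ : Measure X) (f : X → ℝ≥0∞) {i : ι}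
    {x : X} (hx : x ∈ D i) : outSum κ D μ f i ≤ posOp κ D μ f x := by
  refine ENNReal.tsum_le_tsum fun j => ?_
  by_cases h : D i ⊆ D j
  · rw [Set.indicator_of_mem (show j ∈ {j | D i ⊆ D j} from h), Set.indicator_of_mem (h hx)]
  · rw [Set.indicator_of_notMem (show j ∉ {j | D i ⊆ D j} from h)]; exact zero_le

theorem NestedFamily.subset_of_minimalFor {Y : Type*} {D : ι → Set Y} (hD : NestedFamily D)
    {P : ι → Prop} {x : Y} {i j : ι} (hi : MinimalFor P D i) (hxi : x ∈ D i) (hj : P j) (hxj : x ∈ D j) :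
    D i ⊆ D j := by
  rcases hD i j with h | h | h
  · exact h
  · exact hi.2 hj h
  · exact absurd hxj (Set.disjoint_left.1 h hxi)

section Finite

variable {κ : ι → ℝ≥0∞} {D : ι → Set X} {s : Finset ι}

theorem exists_lt_outSum (hD : NestedFamily D) (hs : ∀ i ∉ s, κ i = 0) {μ : Measure X}
    {f : X → ℝ≥0∞} {x : X} {lam : ℝ≥0∞} (hx : lam < posOp κ D μ f x) :
    ∃ i ∈ s, x ∈ D i ∧ lam < outSum κ D μ f i := by
  classical
  have hmem : ∀ j, (D j).indicator (fun _ => κ j * ∫⁻ y in D j, f y ∂μ) x ≠ 0 →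
      j ∈ s ∧ x ∈ D j := by
    intro j hj
    have h1 : x ∈ D j := Set.mem_of_indicator_ne_zero hj
    refine ⟨by_contra fun h2 => hj ?_, h1⟩
    simp [hs j h2]
  have hne : (s.filter (x ∈ D ·)).Nonempty := by
    have h0 : posOp κ D μ f x ≠ 0 := (lt_of_le_of_lt zero_le hx).ne'
    rw [posOp, ne_eq, ENNReal.tsum_eq_zero, not_forall] at h0
    obtain ⟨j, hj⟩ := h0
    exact ⟨j, by simpa using hmem j hj⟩
  obtain ⟨i, hi⟩ := Finset.exists_minimalFor D _ hne
  have hi1 := Finset.mem_filter.1 hi.1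
  refine ⟨i, hi1.1, hi1.2, lt_of_lt_of_le hx (ENNReal.tsum_le_tsum fun j => ?_)⟩
  by_cases hj : (D j).indicator (fun _ => κ j * ∫⁻ y in D j, f y ∂μ) x = 0
  · rw [hj]; exact zero_le
  · have h1 := hmem j hj
    have h2 : D i ⊆ D j :=
      hD.subset_of_minimalFor hi hi1.2 (Finset.mem_filter.2 h1) h1.2
    rw [Set.indicator_of_mem h1.2, Set.indicator_of_mem (show j ∈ {j | D i ⊆ D j} from h2)]

/-- On a maximal set of `{lam < posOp}`, the operator exceeds its local part by at most `lam`. -/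
theorem posOp_le_locCoef_add (hD : NestedFamily D) (hs : ∀ i ∉ s, κ i = 0) {μ : Measure X}
    {f : X → ℝ≥0∞} {lam : ℝ≥0∞} {i₀ : ι}
    (hmax : ∀ k ∈ s, lam < outSum κ D μ f k → D i₀ ⊆ D k → D k ⊆ D i₀) {x : X}
    (hx : x ∈ D i₀) :
    posOp κ D μ f x ≤ posOp (locCoef κ D (D i₀)) D μ f x + lam := by
  classical
  have hsplit : posOp κ D μ f x = posOp (locCoef κ D (D i₀)) D μ f x +
      ∑' j, if D j ⊆ D i₀ then 0 else (D j).indicator (fun _ => κ j * ∫⁻ y in D j, f y ∂μ) x := by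
    rw [posOp, posOp, ← ENNReal.tsum_add]
    refine tsum_congr fun j => ?_
    by_cases h : D j ⊆ D i₀ <;> simp [h, locCoef]
  rw [hsplit]
  gcongr
  have hmem : ∀ j, (if D j ⊆ D i₀ then 0 else
      (D j).indicator (fun _ => κ j * ∫⁻ y in D j, f y ∂μ) x) ≠ 0 →
      j ∈ s ∧ x ∈ D j ∧ ¬ D j ⊆ D i₀ := by
    intro j hj
    by_cases h : D j ⊆ D i₀
    · simp [h] at hj
    · rw [if_neg h] at hj
      have h1 : x ∈ D j := Set.mem_of_indicator_ne_zero hj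
      refine ⟨by_contra fun h2 => hj ?_, h1, h⟩
      simp [hs j h2]
  rcases (s.filter fun j => x ∈ D j ∧ ¬ D j ⊆ D i₀).eq_empty_or_nonempty with he | hne
  · refine le_trans (le_of_eq (ENNReal.tsum_eq_zero.2 fun j => ?_)) zero_le
    by_contra hj
    exact Finset.eq_empty_iff_forall_notMem.1 he j (Finset.mem_filter.2 (hmem j hj))
  · obtain ⟨k, hk⟩ := Finset.exists_minimalFor D _ hne
    have hk1 := Finset.mem_filter.1 hk.1
    have hsub : D i₀ ⊆ D k := by
      rcases hD i₀ k with h | h | h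
      · exact h
      · exact absurd h hk1.2.2
      · exact absurd hk1.2.1 (Set.disjoint_left.1 h hx)
    have hout : outSum κ D μ f k ≤ lam := by
      by_contra h
      exact hk1.2.2 (hmax k hk1.1 (not_le.1 h) hsub)
    refine le_trans (ENNReal.tsum_le_tsum fun j => ?_) hout
    by_cases hj : (if D j ⊆ D i₀ then 0 else
      (D j).indicator (fun _ => κ j * ∫⁻ y in D j, f y ∂μ) x) = 0
    · rw [hj]; exact zero_le
    · have h1 := hmem j hj
      have h2 : D k ⊆ D j :=
        hD.subset_of_minimalFor hk hk1.2.1 (Finset.mem_filter.2 h1) h1.2.1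
      rw [if_neg h1.2.2, Set.indicator_of_mem h1.2.1,
        Set.indicator_of_mem (show j ∈ {j | D k ⊆ D j} from h2)]

end Finite

section GoodLambda

variable [Countable ι] {κ : ι → ℝ≥0∞} {D : ι → Set X} {s : Finset ι} {σ ω : Measure X}
  {p p' q : ℝ} {K : ℝ≥0∞} {f : X → ℝ≥0∞}

theorem setLIntegral_locCoef_le (hD : ∀ i, MeasurableSet (D i)) (hp : p.HolderConjugate p')
    (hf : Measurable f) {R : Set X} (hR : MeasurableSet R) :
    ∫⁻ x in R, posOp (locCoef κ D R) D σ f x ∂ω ≤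
      (∫⁻ x, posOp (locCoef κ D R) D ω 1 x ^ p' ∂σ) ^ (1 / p') *
        (∫⁻ x in R, f x ^ p ∂σ) ^ (1 / p) := by
  have hg := measurable_posOp (locCoef κ D R) hD ω 1
  rw [setLIntegral_posOp_locCoef κ hD σ ω hf hR]
  have h1 : ∫⁻ x, posOp (locCoef κ D R) D ω 1 x * f x ∂σ =
      ∫⁻ x in R, posOp (locCoef κ D R) D ω 1 x * f x ∂σ := by
    rw [← lintegral_indicator hR]
    refine lintegral_congr fun x => ?_
    by_cases hx : x ∈ R
    · simp [hx]
    · simp [hx, posOp_locCoef_of_notMem κ D ω 1 hx]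
  rw [h1]
  refine (ENNReal.lintegral_mul_le_Lp_mul_Lq _ hp.symm hg.aemeasurable hf.aemeasurable).trans ?_
  gcongr
  · exact one_div_nonneg.2 hp.symm.nonneg
  · exact Measure.restrict_le_self

theorem measure_inter_le_of_testing (hD : ∀ i, MeasurableSet (D i))
    (hp : p.HolderConjugate p') (hq : 1 < q) (hf : Measurable f) {R : Set X}
    (hR : MeasurableSet R) (hωR : ω R ≠ ⊤)
    (hK : (∫⁻ x, posOp (locCoef κ D R) D ω 1 x ^ p' ∂σ) ^ (1 / p') ≤ K * ω R ^ (1 - 1 / q))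
    {lam ε : ℝ≥0∞} (hl : 0 < lam) (hlt : lam ≠ ⊤) (hε : 0 < ε) (hεt : ε ≠ ⊤)
    (hle : ∀ x ∈ R, posOp κ D σ f x ≤ posOp (locCoef κ D R) D σ f x + lam) :
    ω (R ∩ {x | 2 * lam < posOp κ D σ f x}) ≤
      ε * ω R + (K * (∫⁻ x in R, f x ^ p ∂σ) ^ (1 / p) / (ε * lam)) ^ q := by
  have hq0 : 0 < q := by linarith
  set E := R ∩ {x | 2 * lam < posOp κ D σ f x} with hE
  set A := (∫⁻ x in R, f x ^ p ∂σ) ^ (1 / p)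
  rcases le_or_gt (ω E) (ε * ω R) with h | h
  · exact h.trans le_self_add
  have hER : ω E ≤ ω R := measure_mono Set.inter_subset_left
  have h0 : ω R ≠ 0 := fun h0 => by
    rw [h0] at hER
    exact absurd h (by rw [le_zero_iff.1 hER]; simp)
  have hT := measurable_posOp (locCoef κ D R) hD σ f
  have hsub : E ⊆ {x | lam ≤ posOp (locCoef κ D R) D σ f x} ∩ R := by
    intro x hx
    refine ⟨?_, hx.1⟩
    have h1 : 2 * lam < posOp (locCoef κ D R) D σ f x + lam := lt_of_lt_of_le hx.2 (hle x hx.1)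
    rw [two_mul] at h1
    exact ((ENNReal.add_lt_add_iff_right hlt).1 h1).le
  have h1 : lam * ω E ≤ K * ω R ^ (1 - 1 / q) * A := by
    calc lam * ω E
        ≤ lam * (ω.restrict R) {x | lam ≤ posOp (locCoef κ D R) D σ f x} := by
          rw [Measure.restrict_apply (measurableSet_le measurable_const hT)]
          gcongr
      _ ≤ ∫⁻ x in R, posOp (locCoef κ D R) D σ f x ∂ω := mul_meas_ge_le_lintegral hT lam
      _ ≤ _ := (setLIntegral_locCoef_le hD hp hf hR).trans (by gcongr)
  have h2 : (ω R ^ (1 / q) * (ε * lam)) * ω R ^ (1 - 1 / q) ≤ (K * A) * ω R ^ (1 - 1 / q) := by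
    calc (ω R ^ (1 / q) * (ε * lam)) * ω R ^ (1 - 1 / q)
        = lam * (ε * (ω R ^ (1 / q) * ω R ^ (1 - 1 / q))) := by ring
      _ = lam * (ε * ω R) := by
          rw [← ENNReal.rpow_add _ _ h0 hωR, add_sub_cancel, ENNReal.rpow_one]
      _ ≤ lam * ω E := by gcongr
      _ ≤ _ := h1.trans (le_of_eq (by ring))
  have h3 : ω R ^ (1 / q) * (ε * lam) ≤ K * A := by
    refine (ENNReal.mul_le_mul_iff_left ?_ ?_).1 h2
    · simp [ENNReal.rpow_eq_zero_iff, h0, hωR]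
    · simp [ENNReal.rpow_eq_top_iff, h0, hωR]
  have h4 : ω R ^ (1 / q) ≤ K * A / (ε * lam) := by
    rw [ENNReal.le_div_iff_mul_le (Or.inl (ENNReal.mul_pos hε.ne' hl.ne').ne')
      (Or.inl (ENNReal.mul_ne_top hεt hlt))]
    exact h3
  calc ω E ≤ ω R := hER
    _ = (ω R ^ (1 / q)) ^ q := by
        rw [← ENNReal.rpow_mul, one_div_mul_cancel hq0.ne', ENNReal.rpow_one]
    _ ≤ (K * A / (ε * lam)) ^ q := ENNReal.rpow_le_rpow h4 hq0.le
    _ ≤ _ := le_add_self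

theorem good_lambda (hD : ∀ i, MeasurableSet (D i)) (hN : NestedFamily D)
    (hs : ∀ i ∉ s, κ i = 0)
    (hp : p.HolderConjugate p') (hq : 1 < q) (hpq : p ≤ q) (hf : Measurable f)
    (hω : ∀ i, ω (D i) ≠ ⊤)
    (hK : ∀ i, (∫⁻ x, posOp (locCoef κ D (D i)) D ω 1 x ^ p' ∂σ) ^ (1 / p') ≤
      K * ω (D i) ^ (1 - 1 / q))
    {lam ε : ℝ≥0∞} (hl : 0 < lam) (hlt : lam ≠ ⊤) (hε : 0 < ε) (hεt : ε ≠ ⊤) :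
    ω {x | 2 * lam < posOp κ D σ f x} ≤ ε * ω {x | lam < posOp κ D σ f x} +
      (K * (∫⁻ x, f x ^ p ∂σ) ^ (1 / p) / (ε * lam)) ^ q := by
  classical
  have hq0 : 0 < q := by linarith
  set 𝒜 := (s.filter fun i => lam < outSum κ D σ f i).image D with h𝒜
  set M := 𝒜.filter (Maximal (· ∈ 𝒜)) with hM
  have hmem : ∀ R ∈ M, ∃ i, R = D i ∧ lam < outSum κ D σ f i ∧
      ∀ k ∈ s, lam < outSum κ D σ f k → D i ⊆ D k → D k ⊆ D i := by
    intro R hR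
    obtain ⟨h1, h2⟩ := Finset.mem_filter.1 hR
    obtain ⟨i, hi, rfl⟩ := Finset.mem_image.1 h1
    refine ⟨i, rfl, (Finset.mem_filter.1 hi).2, fun k hk hk' hik => h2.2 ?_ hik⟩
    exact Finset.mem_image_of_mem D (Finset.mem_filter.2 ⟨hk, hk'⟩)
  have hmeas : ∀ R ∈ M, MeasurableSet R := fun R hR => by
    obtain ⟨i, rfl, -⟩ := hmem R hR; exact hD i
  have hdisj : Set.PairwiseDisjoint (M : Set (Set X)) id := by
    intro R hR R' hR' hne
    have h1 := (Finset.mem_filter.1 hR).2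
    have h2 := (Finset.mem_filter.1 hR').2
    obtain ⟨i, hi, -⟩ := hmem R hR
    obtain ⟨j, hj, -⟩ := hmem R' hR'
    have h3 := hN i j
    rw [← hi, ← hj] at h3
    rcases h3 with h | h | h
    · exact absurd (h1.eq_of_le h2.1 h) hne
    · exact absurd (h2.eq_of_le h1.1 h).symm hne
    · exact h
  have hcover : {x | lam < posOp κ D σ f x} = ⋃ R ∈ M, R := by
    ext x
    simp only [Set.mem_ofPred_eq, Set.mem_iUnion, exists_prop]
    constructor
    · intro hx
      obtain ⟨i, his, hxi, hi⟩ := exists_lt_outSum hN hs hx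
      have hiA : D i ∈ 𝒜 := Finset.mem_image_of_mem D (Finset.mem_filter.2 ⟨his, hi⟩)
      obtain ⟨R, hiR, hR⟩ := 𝒜.exists_le_maximal hiA
      exact ⟨R, Finset.mem_filter.2 ⟨hR.1, hR⟩, hiR hxi⟩
    · rintro ⟨R, hR, hx⟩
      obtain ⟨i, rfl, hi, -⟩ := hmem R hR
      exact lt_of_lt_of_le hi (outSum_le_posOp κ D σ f hx)
  have hsub : {x | 2 * lam < posOp κ D σ f x} ⊆
      ⋃ R ∈ M, R ∩ {x | 2 * lam < posOp κ D σ f x} := by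
    intro x hx
    have hlx : lam < posOp κ D σ f x :=
      lt_of_le_of_lt (le_mul_of_one_le_left zero_le one_le_two) hx
    have : x ∈ {x | lam < posOp κ D σ f x} := hlx
    rw [hcover] at this
    simp only [Set.mem_iUnion, exists_prop] at this ⊢
    obtain ⟨R, hR, hxR⟩ := this
    exact ⟨R, hR, hxR, hx⟩
  have hsum : ∑ R ∈ M, ω R = ω {x | lam < posOp κ D σ f x} := by
    rw [hcover]
    exact (measure_biUnion_finset hdisj hmeas).symm
  have hsumf : ∑ R ∈ M, ∫⁻ x in R, f x ^ p ∂σ ≤ ∫⁻ x, f x ^ p ∂σ := by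
    refine (lintegral_biUnion_finset (t := id) hdisj hmeas (fun x => f x ^ p)).symm.le.trans ?_
    exact setLIntegral_le_lintegral _ _
  set c := K / (ε * lam) with hc
  have hcq : ∀ I : ℝ≥0∞, (K * I ^ (1 / p) / (ε * lam)) ^ q = c ^ q * I ^ (q / p) := by
    intro I
    rw [mul_comm K, mul_div_assoc, ENNReal.mul_rpow_of_nonneg _ _ hq0.le, ← ENNReal.rpow_mul,
      one_div_mul_eq_div, mul_comm]
  rw [hcq]
  calc ω {x | 2 * lam < posOp κ D σ f x}
      ≤ ∑ R ∈ M, ω (R ∩ {x | 2 * lam < posOp κ D σ f x}) :=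
        (measure_mono hsub).trans (measure_biUnion_finset_le _ _)
    _ ≤ ∑ R ∈ M, (ε * ω R + c ^ q * (∫⁻ x in R, f x ^ p ∂σ) ^ (q / p)) := by
        refine Finset.sum_le_sum fun R hR => ?_
        obtain ⟨i, rfl, hi, hmax⟩ := hmem R hR
        rw [← hcq]
        exact measure_inter_le_of_testing hD hp hq hf (hD i) (hω i) (hK i) hl hlt hε hεt
          fun x hx => posOp_le_locCoef_add hN hs hmax hx
    _ ≤ _ := by
        rw [Finset.sum_add_distrib, ← Finset.mul_sum, ← Finset.mul_sum, hsum]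
        gcongr
        refine (sum_rpow_le_rpow_sum _ _ ((one_le_div hp.pos).2 hpq)).trans ?_
        gcongr
        exact div_nonneg hq0.le hp.nonneg

/-- The constant in the weak-type inequality deduced from local testing. -/
def weakTestConst (q : ℝ) : ℝ≥0∞ := (2 * 2 ^ q) ^ (1 / q) * (2 * 2 ^ q)

theorem setLIntegral_ne_top_of_rpow (hp : 1 < p) (hfp : ∫⁻ x, f x ^ p ∂σ ≠ ⊤) {R : Set X}
    (hR : σ R ≠ ⊤) : ∫⁻ x in R, f x ∂σ ≠ ⊤ := by
  refine ne_top_of_le_ne_top (ENNReal.add_ne_top.2 ⟨hR, hfp⟩) (b := σ R + ∫⁻ x, f x ^ p ∂σ) ?_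
  calc ∫⁻ x in R, f x ∂σ ≤ ∫⁻ x in R, (1 + f x ^ p) ∂σ := by
        refine lintegral_mono fun x => ?_
        rcases le_total (f x) 1 with h | h
        · exact h.trans le_self_add
        · refine le_trans ?_ le_add_self
          simpa using ENNReal.rpow_le_rpow_of_exponent_le h hp.le
    _ = σ R + ∫⁻ x in R, f x ^ p ∂σ := by
        rw [lintegral_add_left measurable_const, setLIntegral_const, one_mul]
    _ ≤ _ := by gcongr; exact Measure.restrict_le_self

theorem weak_of_testing_of_finite (hD : ∀ i, MeasurableSet (D i)) (hN : NestedFamily D)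
    (hs : ∀ i ∉ s, κ i = 0) (hκ : ∀ i, κ i ≠ ⊤)
    (hp : p.HolderConjugate p') (hpq : p ≤ q) (hf : Measurable f)
    (hfp : ∫⁻ x, f x ^ p ∂σ ≠ ⊤)
    (hσ : ∀ i, σ (D i) ≠ ⊤) (hω : ∀ i, ω (D i) ≠ ⊤)
    (hK : ∀ i, (∫⁻ x, posOp (locCoef κ D (D i)) D ω 1 x ^ p' ∂σ) ^ (1 / p') ≤
      K * ω (D i) ^ (1 - 1 / q)) {lam : ℝ≥0∞} (hl : 0 < lam) :
    ω {x | lam < posOp κ D σ f x} ≤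
      (weakTestConst q * K * (∫⁻ x, f x ^ p ∂σ) ^ (1 / p) / lam) ^ q := by
  classical
  have hq : 1 < q := lt_of_lt_of_le hp.lt hpq
  have hq0 : 0 < q := by linarith
  rcases eq_or_ne lam ⊤ with rfl | hlt
  · simp
  set F := (∫⁻ x, f x ^ p ∂σ) ^ (1 / p) with hF
  set B := ∑ i ∈ s, κ i * ∫⁻ y in D i, f y ∂σ with hB
  have hBt : B ≠ ⊤ := ENNReal.sum_ne_top.2 fun i _ =>
    ENNReal.mul_ne_top (hκ i) (setLIntegral_ne_top_of_rpow hp.lt hfp (hσ i))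
  have hTB : ∀ x, posOp κ D σ f x ≤ B := by
    intro x
    rw [posOp, tsum_eq_sum (s := s) fun i hi => by simp [hs i hi]]
    exact Finset.sum_le_sum fun i _ => Set.indicator_le_self' (fun _ _ => zero_le) x
  set W := ∑ i ∈ s, ω (D i) with hW
  have hWt : W ≠ ⊤ := ENNReal.sum_ne_top.2 fun i _ => hω i
  set A := ⨆ l : NNReal, (l : ℝ≥0∞) ^ q * ω {x | (l : ℝ≥0∞) < posOp κ D σ f x} with hA
  have hAt : A ≠ ⊤ := by
    refine ne_top_of_le_ne_top
      (ENNReal.mul_ne_top (ENNReal.rpow_ne_top_of_nonneg hq0.le hBt) hWt) (iSup_le fun l => ?_)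
    rcases {x | (l : ℝ≥0∞) < posOp κ D σ f x}.eq_empty_or_nonempty with he | ⟨x, hx⟩
    · simp [he]
    · gcongr
      · exact (lt_of_lt_of_le hx (hTB x)).le
      · refine (measure_mono fun y hy => ?_).trans (measure_biUnion_finset_le s D)
        obtain ⟨i, his, hyi, -⟩ := exists_lt_outSum hN hs hy
        exact Set.mem_biUnion his hyi
  set b : ℝ≥0∞ := 2 * 2 ^ q with hb
  have hb0 : b ≠ 0 := by simp [hb, ENNReal.rpow_eq_zero_iff]
  have hbt : b ≠ ⊤ := ENNReal.mul_ne_top (by simp) (ENNReal.rpow_ne_top_of_nonneg hq0.le (by simp))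
  have hstep : A ≤ A / 2 + 2 ^ q * (b * (K * F)) ^ q := by
    refine iSup_le fun l => ?_
    rcases eq_or_ne l 0 with rfl | hl0
    · simp [hq0]
    set m : ℝ≥0∞ := ((l / 2 : NNReal) : ℝ≥0∞) with hm
    have hm0 : 0 < m := by simpa [hm, pos_iff_ne_zero] using hl0
    have hmt : m ≠ ⊤ := ENNReal.coe_ne_top
    have hlm : (l : ℝ≥0∞) = 2 * m := by
      rw [hm, ← ENNReal.coe_ofNat, ← ENNReal.coe_mul, mul_div_cancel₀ _ two_ne_zero]
    have hg := good_lambda (ε := b⁻¹) hD hN hs hp hq hpq hf hω hK hm0 hmt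
      (ENNReal.inv_pos.2 hbt) (ENNReal.inv_ne_top.2 hb0)
    rw [← hF, ← hlm] at hg
    have hle : m ^ q * ω {x | m < posOp κ D σ f x} ≤ A :=
      le_iSup (fun l : NNReal => (l : ℝ≥0∞) ^ q * ω {x | (l : ℝ≥0∞) < posOp κ D σ f x}) (l / 2)
    have hlq : (l : ℝ≥0∞) ^ q = 2 ^ q * m ^ q := by
      rw [hlm, ENNReal.mul_rpow_of_nonneg _ _ hq0.le]
    have hcan : m ^ q * (K * F / (b⁻¹ * m)) ^ q = (b * (K * F)) ^ q := by
      rw [← ENNReal.mul_rpow_of_nonneg _ _ hq0.le]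
      congr 1
      rw [div_eq_mul_inv, ENNReal.mul_inv (Or.inr hmt) (Or.inr hm0.ne'), inv_inv]
      calc m * (K * F * (b * m⁻¹)) = (m * m⁻¹) * (b * (K * F)) := by ring
        _ = _ := by rw [ENNReal.mul_inv_cancel hm0.ne' hmt, one_mul]
    have hb2 : 2 ^ q * b⁻¹ = (2 : ℝ≥0∞)⁻¹ := by
      rw [hb, ENNReal.mul_inv (by simp) (by simp), mul_left_comm, ENNReal.mul_inv_cancel, mul_one]
      · simp [ENNReal.rpow_eq_zero_iff]
      · exact ENNReal.rpow_ne_top_of_nonneg hq0.le (by simp)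
    calc (l : ℝ≥0∞) ^ q * ω {x | (l : ℝ≥0∞) < posOp κ D σ f x}
        ≤ 2 ^ q * m ^ q * (b⁻¹ * ω {x | m < posOp κ D σ f x} + (K * F / (b⁻¹ * m)) ^ q) := by
          rw [hlq]; gcongr
      _ = (2 ^ q * b⁻¹) * (m ^ q * ω {x | m < posOp κ D σ f x}) +
            2 ^ q * (m ^ q * (K * F / (b⁻¹ * m)) ^ q) := by ring
      _ ≤ A / 2 + 2 ^ q * (b * (K * F)) ^ q := by
          rw [hcan, hb2, ENNReal.div_eq_inv_mul]; gcongr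
  have hfinal : A ≤ 2 * (2 ^ q * (b * (K * F)) ^ q) := by
    have h1 : A / 2 ≤ 2 ^ q * (b * (K * F)) ^ q := by
      have h2 : A / 2 + A / 2 ≤ A / 2 + 2 ^ q * (b * (K * F)) ^ q := by
        rwa [ENNReal.add_halves]
      exact (ENNReal.add_le_add_iff_left (ENNReal.div_ne_top hAt two_ne_zero)).1 h2
    calc A = A / 2 + A / 2 := (ENNReal.add_halves A).symm
      _ ≤ _ := by rw [two_mul]; gcongr
  lift lam to NNReal using hlt
  have h3 : (lam : ℝ≥0∞) ^ q * ω {x | (lam : ℝ≥0∞) < posOp κ D σ f x} ≤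
      b * (b * (K * F)) ^ q := by
    refine ((le_iSup (fun l : NNReal =>
      (l : ℝ≥0∞) ^ q * ω {x | (l : ℝ≥0∞) < posOp κ D σ f x}) lam).trans hfinal).trans ?_
    rw [hb, ← mul_assoc]
  have h4 : (weakTestConst q * K * F / lam) ^ q = b * (b * (K * F)) ^ q / (lam : ℝ≥0∞) ^ q := by
    rw [ENNReal.div_rpow_of_nonneg _ _ hq0.le, weakTestConst, ← hb, mul_assoc, mul_assoc,
      ENNReal.mul_rpow_of_nonneg _ _ hq0.le, ← ENNReal.rpow_mul, one_div_mul_cancel hq0.ne',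
      ENNReal.rpow_one]
  rw [h4, ENNReal.le_div_iff_mul_le
    (Or.inl (by simpa [ENNReal.rpow_eq_zero_iff, hq0.le, hq0] using hl.ne'))
    (Or.inl (ENNReal.rpow_ne_top_of_nonneg hq0.le ENNReal.coe_ne_top)), mul_comm]
  exact h3

end GoodLambda

/-- **Local testing implies the weak-type inequality**, for a countable nested family. -/
theorem weak_of_testing [Countable ι] {κ : ι → ℝ≥0∞} {D : ι → Set X} {σ ω : Measure X}
    {p p' q : ℝ} {K : ℝ≥0∞} {f : X → ℝ≥0∞}
    (hD : ∀ i, MeasurableSet (D i)) (hN : NestedFamily D)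
    (hp : p.HolderConjugate p') (hpq : p ≤ q) (hf : Measurable f)
    (hfp : ∫⁻ x, f x ^ p ∂σ ≠ ⊤)
    (hσ : ∀ i, σ (D i) ≠ ⊤) (hω : ∀ i, ω (D i) ≠ ⊤)
    (hK : ∀ i, (∫⁻ x, posOp (locCoef κ D (D i)) D ω 1 x ^ p' ∂σ) ^ (1 / p') ≤
      K * ω (D i) ^ (1 - 1 / q)) {lam : ℝ≥0∞} (hl : 0 < lam) :
    ω {x | lam < posOp κ D σ f x} ≤
      (weakTestConst q * K * (∫⁻ x, f x ^ p ∂σ) ^ (1 / p) / lam) ^ q := by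
  classical
  set κ' : Finset ι × ℕ → ι → ℝ≥0∞ := fun t i => if i ∈ t.1 then min (κ i) t.2 else 0 with hκ'
  have hle : ∀ t, κ' t ≤ κ := fun t i => by
    simp only [hκ']; split_ifs <;> simp
  have hmono : Monotone κ' := by
    rintro ⟨t, n⟩ ⟨t', n'⟩ ⟨h1, h2⟩ i
    simp only [hκ']
    by_cases h : i ∈ t
    · rw [if_pos h, if_pos (h1 h)]
      exact min_le_min le_rfl (by exact_mod_cast h2)
    · rw [if_neg h]; exact zero_le
  have hcover : {x | lam < posOp κ D σ f x} ⊆ ⋃ t, {x | lam < posOp (κ' t) D σ f x} := by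
    intro x hx
    have hx' : lam < posOp κ D σ f x := hx
    rw [posOp, ENNReal.tsum_eq_iSup_sum, lt_iSup_iff] at hx'
    obtain ⟨t, ht⟩ := hx'
    have hsup : ∑ i ∈ t, (D i).indicator (fun _ => κ i * ∫⁻ y in D i, f y ∂σ) x =
        ⨆ n : ℕ, ∑ i ∈ t,
          (D i).indicator (fun _ => min (κ i) (n : ℝ≥0∞) * ∫⁻ y in D i, f y ∂σ) x := by
      rw [← ENNReal.finsetSum_iSup_of_monotone]
      · refine Finset.sum_congr rfl fun i _ => ?_
        by_cases hxi : x ∈ D i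
        · simp only [Set.indicator_of_mem hxi]
          rw [← ENNReal.iSup_mul, ← inf_iSup_eq, ENNReal.iSup_natCast, inf_top_eq]
        · simp [hxi]
      · intro i m n hmn
        refine Set.indicator_le_indicator ?_
        gcongr
    rw [hsup, lt_iSup_iff] at ht
    obtain ⟨n, hn⟩ := ht
    refine Set.mem_iUnion.2 ⟨(t, n), ?_⟩
    have h1 : lam < posOp (κ' (t, n)) D σ f x := by
      refine lt_of_lt_of_le hn (le_trans (le_of_eq ?_) (ENNReal.sum_le_tsum t))
      exact Finset.sum_congr rfl fun i hi => by simp [hκ', hi]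
    exact h1
  have hdir : Directed (· ⊆ ·) fun t => {x | lam < posOp (κ' t) D σ f x} := by
    refine Monotone.directed_le (f := fun t => {x | lam < posOp (κ' t) D σ f x}) ?_
    intro t t' htt' x hx
    exact lt_of_lt_of_le hx (posOp_mono (hmono htt') D σ f x)
  refine (measure_mono hcover).trans ?_
  rw [hdir.measure_iUnion]
  refine iSup_le fun t => ?_
  refine weak_of_testing_of_finite (s := t.1) hD hN (fun i hi => by simp [hκ', hi]) (fun i => ?_)
    hp hpq hf hfp hσ hω (fun i => le_trans ?_ (hK i)) hl
  · exact ne_top_of_le_ne_top (ENNReal.natCast_ne_top t.2) (by simp only [hκ']; split_ifs <;> simp)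
  · have hp' := hp.symm.pos
    gcongr with x
    exact posOp_mono (locCoef_mono (hle t) D (D i)) D ω 1 x

end General

section Dyadic

variable {d : ℕ}

theorem dcube_subset_or_disjoint {i j : DIdx d} (h : i.1 ≤ j.1) :
    dcube i ⊆ dcube j ∨ Disjoint (dcube i) (dcube j) := by
  by_cases hd : Disjoint (dcube i) (dcube j)
  · exact Or.inr hd
  refine Or.inl fun y hy l => ?_
  obtain ⟨x, hxi, hxj⟩ := Set.not_disjoint_iff.1 hd
  have hx1 := hxi l
  have hx2 := hxj l
  have hy1 := hy l
  obtain ⟨k, hk⟩ := Int.le.dest h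
  have hpow : (2 : ℝ) ^ j.1 = 2 ^ i.1 * 2 ^ k := by
    rw [← hk, zpow_add₀ two_ne_zero, zpow_natCast]
  have h0 : (0 : ℝ) < 2 ^ i.1 := by positivity
  rw [hpow] at hx2 ⊢
  simp only [Set.mem_Ico, mul_assoc] at hx1 hx2 hy1 ⊢
  have h1 : (i.2 l : ℝ) < 2 ^ k * ((j.2 l : ℝ) + 1) :=
    lt_of_mul_lt_mul_left (hx1.1.trans_lt hx2.2) h0.le
  have h2 : (2 : ℝ) ^ k * (j.2 l : ℝ) < (i.2 l : ℝ) + 1 :=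
    lt_of_mul_lt_mul_left (hx2.1.trans_lt hx1.2) h0.le
  have h3 : i.2 l + 1 ≤ 2 ^ k * (j.2 l + 1) := by
    have : i.2 l < 2 ^ k * (j.2 l + 1) := by exact_mod_cast h1
    omega
  have h4 : 2 ^ k * j.2 l ≤ i.2 l := by
    have : 2 ^ k * j.2 l < i.2 l + 1 := by exact_mod_cast h2
    omega
  have h3' : (i.2 l : ℝ) + 1 ≤ 2 ^ k * ((j.2 l : ℝ) + 1) := by exact_mod_cast h3
  have h4' : (2 : ℝ) ^ k * (j.2 l : ℝ) ≤ i.2 l := by exact_mod_cast h4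
  exact ⟨(mul_le_mul_of_nonneg_left h4' h0.le).trans hy1.1,
    hy1.2.trans_le (mul_le_mul_of_nonneg_left h3' h0.le)⟩

theorem nestedFamily_dcube : NestedFamily (dcube (d := d)) := by
  intro i j
  rcases le_total i.1 j.1 with h | h
  · exact (dcube_subset_or_disjoint h).imp_right Or.inr
  · exact Or.inr ((dcube_subset_or_disjoint h).imp_right fun hd => hd.symm)

/-- The coefficients of the dyadic operator with the averages replaced by integrals. -/
def dyCoef (τ : DIdx d → ℝ≥0∞) (i : DIdx d) : ℝ≥0∞ := τ i / volume (dcube i)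

theorem mul_lavg_eq (τ : DIdx d → ℝ≥0∞) (i : DIdx d) (f : (Fin d → ℝ) → ℝ≥0∞) :
    τ i * lavg i f = dyCoef τ i * ∫⁻ x in dcube i, f x := by
  simp only [lavg, cavg, dyCoef, div_eq_mul_inv]; ring

theorem Tdy_mul_eq_posOp (τ : DIdx d → ℝ≥0∞) {σ f : (Fin d → ℝ) → ℝ≥0∞} (hσ : Measurable σ)
    (hf : Measurable f) (x : Fin d → ℝ) :
    Tdy τ (fun y => f y * σ y) x = posOp (dyCoef τ) dcube (wMeasure σ) f x := by
  refine tsum_congr fun i => ?_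
  rw [mul_lavg_eq, wMeasure,
    setLIntegral_withDensity_eq_setLIntegral_mul _ hσ hf (measurableSet_dcube i)]
  simp only [Pi.mul_apply, mul_comm (σ _)]

theorem TdyIn_indicator_eq_posOp (τ : DIdx d → ℝ≥0∞) (R : DIdx d) (ω : (Fin d → ℝ) → ℝ≥0∞)
    (x : Fin d → ℝ) :
    TdyIn τ R ((dcube R).indicator ω) x =
      posOp (locCoef (dyCoef τ) dcube (dcube R)) dcube (wMeasure ω) 1 x := by
  refine (tsum_subtype {i : DIdx d | dcube i ⊆ dcube R} fun i =>
    (dcube i).indicator (fun _ => τ i * lavg i ((dcube R).indicator ω)) x).trans ?_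
  refine tsum_congr fun i => ?_
  by_cases h : dcube i ⊆ dcube R
  · rw [Set.indicator_of_mem (show i ∈ {i : DIdx d | dcube i ⊆ dcube R} from h), mul_lavg_eq,
      locCoef, if_pos h]
    have h1 : ∫⁻ x in dcube i, (dcube R).indicator ω x = wMeasure ω (dcube i) := by
      rw [wMeasure, withDensity_apply _ (measurableSet_dcube i)]
      exact setLIntegral_congr_fun (measurableSet_dcube i) fun y hy =>
        Set.indicator_of_mem (h hy) ω
    rw [h1]
    simp
  · rw [Set.indicator_of_notMem (show i ∉ {i : DIdx d | dcube i ⊆ dcube R} from h), locCoef,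
      if_neg h]
    simp

theorem lpn_TdyIn_le_locTest {p q : ℝ} (hp : 1 < p) (hq : 1 < q) (τ : DIdx d → ℝ≥0∞)
    (σ ω : (Fin d → ℝ) → ℝ≥0∞) {R : DIdx d} (hR : wMeasure ω (dcube R) ≠ ⊤) :
    lpn (p / (p - 1)) (wMeasure σ) (TdyIn τ R ((dcube R).indicator ω)) ≤
      locTest p q τ σ ω * wMeasure ω (dcube R) ^ (1 - 1 / q) := by
  by_cases h0 : wMeasure ω (dcube R) = 0
  · have hp' : 0 < p / (p - 1) := div_pos (by linarith) (by linarith)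
    have hz : ∀ x, TdyIn τ R ((dcube R).indicator ω) x = 0 := by
      intro x
      rw [TdyIn_indicator_eq_posOp]
      refine ENNReal.tsum_eq_zero.2 fun i => ?_
      by_cases h : dcube i ⊆ dcube R
      · simp [measure_mono_null h h0]
      · simp [locCoef, h]
    simp only [lpn, hz]
    rw [ENNReal.zero_rpow_of_pos hp', lintegral_zero, ENNReal.zero_rpow_of_pos (by positivity)]
    exact zero_le
  · have h1 : wMeasure ω (dcube R) ^ (-(1 / (q / (q - 1)))) *
        lpn (p / (p - 1)) (wMeasure σ) (TdyIn τ R ((dcube R).indicator ω)) ≤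
        locTest p q τ σ ω := le_iSup₂_of_le R h0 le_rfl
    have he : 1 / (q / (q - 1)) = 1 - 1 / q := by
      have : q ≠ 0 := by linarith
      have : q - 1 ≠ 0 := by linarith
      field_simp
    rw [he] at h1
    calc lpn (p / (p - 1)) (wMeasure σ) (TdyIn τ R ((dcube R).indicator ω))
        = (wMeasure ω (dcube R) ^ (-(1 - 1 / q)) *
            lpn (p / (p - 1)) (wMeasure σ) (TdyIn τ R ((dcube R).indicator ω))) *
            wMeasure ω (dcube R) ^ (1 - 1 / q) := by
          rw [mul_right_comm, ← ENNReal.rpow_add _ _ h0 hR, neg_add_cancel, ENNReal.rpow_zero,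
            one_mul]
      _ ≤ _ := by gcongr

theorem weakTestConst_pos (q : ℝ) : 0 < weakTestConst q := by
  simp [weakTestConst, pos_iff_ne_zero, ENNReal.rpow_eq_zero_iff, ENNReal.mul_eq_top]

theorem weakTestConst_lt_top {q : ℝ} (hq : 0 < q) : weakTestConst q < ⊤ := by
  have h : (2 * 2 ^ q : ℝ≥0∞) ≠ ⊤ :=
    ENNReal.mul_ne_top (by simp) (ENNReal.rpow_ne_top_of_nonneg hq.le (by simp))
  exact (ENNReal.mul_ne_top (ENNReal.rpow_ne_top_of_nonneg (by positivity) h) h).lt_top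

theorem locTest_le_weakConst {p q : ℝ} (hp : 1 < p) (hq : 1 < q) (τ : DIdx d → ℝ≥0∞)
    {σ ω : (Fin d → ℝ) → ℝ≥0∞} (hσ : Measurable σ)
    (hσt : ∀ i : DIdx d, wMeasure σ (dcube i) ≠ ⊤)
    (hωt : ∀ i : DIdx d, wMeasure ω (dcube i) ≠ ⊤) :
    (weakEmbConst q)⁻¹ * locTest p q τ σ ω ≤ weakConst p q τ σ ω := by
  have hw0 : weakEmbConst q ≠ 0 := (zero_lt_one.trans_le (one_le_weakEmbConst q)).ne'
  refine le_sInf fun N hN => ?_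
  rw [← ENNReal.div_eq_inv_mul]
  refine ENNReal.div_le_of_le_mul' (iSup₂_le fun R h0 => ?_)
  rcases eq_or_ne N ⊤ with rfl | hNt
  · rw [ENNReal.mul_top hw0]; exact le_top
  have hconj : p.HolderConjugate (p / (p - 1)) := Real.HolderConjugate.conjExponent hp
  have key := testing_of_weak hconj hq (dyCoef τ) measurableSet_dcube (wMeasure σ) (wMeasure ω)
    hNt (fun f hf hfp lam hl => ?_) (measurableSet_dcube R) (hσt R) (hωt R) h0
  · have he : 1 / (q / (q - 1)) = 1 - 1 / q := by
      have : q ≠ 0 := by linarith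
      have : q - 1 ≠ 0 := by linarith
      field_simp
    simp only [lpn, TdyIn_indicator_eq_posOp, he]
    calc _ ≤ wMeasure ω (dcube R) ^ (-(1 - 1 / q)) *
          (weakEmbConst q * N * wMeasure ω (dcube R) ^ (1 - 1 / q)) := by gcongr
      _ = weakEmbConst q * N * wMeasure ω (dcube R) ^ (-(1 - 1 / q) + (1 - 1 / q)) := by
          rw [ENNReal.rpow_add _ _ h0 (hωt R)]; ring
      _ = weakEmbConst q * N := by rw [neg_add_cancel, ENNReal.rpow_zero, mul_one]
  · have := hN f hf (ENNReal.rpow_ne_top_of_nonneg (one_div_nonneg.2 hconj.nonneg) hfp) lam hl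
    simpa only [Tdy_mul_eq_posOp τ hσ hf, lpn] using this

theorem weakConst_le_locTest {p q : ℝ} (hp : 1 < p) (hpq : p ≤ q) (τ : DIdx d → ℝ≥0∞)
    {σ ω : (Fin d → ℝ) → ℝ≥0∞} (hσ : Measurable σ)
    (hσt : ∀ i : DIdx d, wMeasure σ (dcube i) ≠ ⊤)
    (hωt : ∀ i : DIdx d, wMeasure ω (dcube i) ≠ ⊤) :
    weakConst p q τ σ ω ≤ weakTestConst q * locTest p q τ σ ω := by
  have hconj : p.HolderConjugate (p / (p - 1)) := Real.HolderConjugate.conjExponent hp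
  refine sInf_le fun f hf hfp lam hl => ?_
  simp only [Tdy_mul_eq_posOp τ hσ hf, lpn]
  refine weak_of_testing measurableSet_dcube nestedFamily_dcube hconj hpq hf (fun h => hfp ?_)
    hσt hωt (fun i => ?_) hl
  · rw [lpn, h, ENNReal.top_rpow_of_pos (one_div_pos.2 hconj.pos)]
  · have := lpn_TdyIn_le_locTest hp (hp.trans_le hpq) τ σ ω (hωt i)
    simpa only [lpn, TdyIn_indicator_eq_posOp] using this

end Dyadic

/-- **Weak-type characterization by local testing, `1 < p ≤ q < ∞`.** -/
theorem stmt4 (d : ℕ) (p q : ℝ) (hp : 1 < p) (hpq : p ≤ q) :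
    ∃ c C : ℝ≥0∞, 0 < c ∧ c < ⊤ ∧ 0 < C ∧ C < ⊤ ∧
      ∀ (τ : DIdx d → ℝ≥0∞) (σ ω : (Fin d → ℝ) → ℝ≥0∞),
        Measurable σ → Measurable ω →
        (∀ i : DIdx d, wMeasure σ (dcube i) ≠ ⊤) →
        (∀ i : DIdx d, wMeasure ω (dcube i) ≠ ⊤) →
        c * locTest p q τ σ ω ≤ weakConst p q τ σ ω ∧
          weakConst p q τ σ ω ≤ C * locTest p q τ σ ω := by
  have hq : 1 < q := hp.trans_le hpq
  exact ⟨(weakEmbConst q)⁻¹, weakTestConst q, ENNReal.inv_pos.2 (weakEmbConst_ne_top hq),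
    ENNReal.inv_lt_top.2 (zero_lt_one.trans_le (one_le_weakEmbConst q)), weakTestConst_pos q,
    weakTestConst_lt_top (by linarith), fun τ σ ω hσ _ hσt hωt =>
      ⟨locTest_le_weakConst hp hq τ hσ hσt hωt, weakConst_le_locTest hp hpq τ hσ hσt hωt⟩⟩
end
end
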